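/- Let G be a finitely generated nilpotent group whose centralized isoperimetric function satisfies δ^cent(n) = Ω(n^k) for some real number k ≥ 2. Then the averaged Dehn function of any finite presentation of G satisfies δ^avg(n) = Ω(n^{k/2}). -/

import Mathlib

/-!
Statement 3: If `G` is a finitely generated nilpotent group whose centralized isoperimetric
function satisfies `δ^cent(n) = Ω(n^k)` for a real `k ≥ 2`, then the averaged Dehn function
of any finite presentation of `G` satisfies `δ^avg(n) = Ω(n^(k/2))`.
-/

namespace AvgDehnPaper

variable {d s : ℕ}

/-- The normal closure of the relators: `R ⊆ F`. -/
def relSubgroup (r : Fin s → FreeGroup (Fin d)) : Subgroup (FreeGroup (Fin d)) :=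
  Subgroup.normalClosure (Set.range r)

instance (r : Fin s → FreeGroup (Fin d)) : (relSubgroup r).Normal :=
  Subgroup.normalClosure_normal

/-- The filling area `δ(w)` of a word `w` representing the identity: the least `k` such
that `w` is a product of `k` conjugates of relators (or their inverses) in `F`. -/
noncomputable def fillingArea (r : Fin s → FreeGroup (Fin d)) (w : FreeGroup (Fin d)) : ℕ :=
  sInf { k | ∃ (g : Fin k → FreeGroup (Fin d)) (a : Fin k → Fin s) (ε : Fin k → Bool),
    w = (List.ofFn (fun i => (g i)⁻¹ * (r (a i)) ^ (if ε i then (1 : ℤ) else -1) * g i)).prod }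

/-- The Dehn function `δ(n)`: the maximal filling area over words of length at most `n`
representing the identity. -/
noncomputable def dehn (r : Fin s → FreeGroup (Fin d)) (n : ℕ) : ℕ :=
  sSup { A | ∃ w ∈ relSubgroup r, FreeGroup.norm w ≤ n ∧ A = fillingArea r w }

/-- A lazy letter: either the identity (`none`) or a generator or its inverse. -/
abbrev Letter (d : ℕ) := Option (Fin d × Bool)

/-- The value of a lazy letter in the free group. -/
def letterVal : Letter d → FreeGroup (Fin d)
  | none => 1
  | some (i, b) => if b then FreeGroup.of i else (FreeGroup.of i)⁻¹

/-- The element of the free group spelled by the first `t` letters of a lazy word. -/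
def partialProd {n : ℕ} (w : Fin n → Letter d) (t : ℕ) : FreeGroup (Fin d) :=
  (((List.ofFn w).take t).map letterVal).prod

open scoped Classical in
/-- The (finite, nonempty) set of lazy words of length `n` representing the identity in `G`. -/
noncomputable def closedWords (r : Fin s → FreeGroup (Fin d)) (n : ℕ) :
    Finset (Fin n → Letter d) :=
  Finset.univ.filter (fun w => partialProd w n ∈ relSubgroup r)

/-- The averaged Dehn function: the average of `δ(w)` over all lazy words of length `n`
representing the identity, with respect to the uniform measure. -/
noncomputable def avgDehn (r : Fin s → FreeGroup (Fin d)) (n : ℕ) : ℝ :=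
  (∑ w ∈ closedWords r n, (fillingArea r (partialProd w n) : ℝ)) /
    ((closedWords r n).card : ℝ)

/-- The subgroup `[R,F]` of the free group. -/
def commRF (r : Fin s → FreeGroup (Fin d)) : Subgroup (FreeGroup (Fin d)) :=
  ⁅relSubgroup r, (⊤ : Subgroup (FreeGroup (Fin d)))⁆

/-- The centralized filling area `δ^cent(w)`: the least `k` such that
`w ∈ (∏_{i=1}^k r_{a_i}^{±1})[R,F]`. -/
noncomputable def centFillingArea (r : Fin s → FreeGroup (Fin d))
    (w : FreeGroup (Fin d)) : ℕ :=
  sInf { k | ∃ (a : Fin k → Fin s) (ε : Fin k → Bool),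
    ((List.ofFn (fun i => (r (a i)) ^ (if ε i then (1 : ℤ) else -1))).prod)⁻¹ * w ∈ commRF r }

/-- The centralized isoperimetric function `δ^cent(n)`. -/
noncomputable def centDehn (r : Fin s → FreeGroup (Fin d)) (n : ℕ) : ℕ :=
  sSup { A | ∃ w ∈ relSubgroup r, FreeGroup.norm w ≤ n ∧ A = centFillingArea r w }

section Collection

variable {G α : Type*} [Group G]

/-- The value of a formal iterated commutator in the letters `α`. -/
def treeEval (g : α → G) : FreeMagma α → G
  | .of a => g a
  | .mul u v => (treeEval g u)⁻¹ * (treeEval g v)⁻¹ * treeEval g u * treeEval g v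

@[simp] lemma treeEval_of (g : α → G) (a : α) : treeEval g (FreeMagma.of a) = g a := rfl

@[simp] lemma treeEval_mul (g : α → G) (u v : FreeMagma α) :
    treeEval g (u * v) = (treeEval g u)⁻¹ * (treeEval g v)⁻¹ * treeEval g u * treeEval g v := rfl

/-- The value of a word whose letters are formal commutators. -/
def wordEval (g : α → G) (l : List (FreeMagma α)) : G := (l.map (treeEval g)).prod

@[simp] lemma wordEval_nil (g : α → G) : wordEval g [] = 1 := rfl

@[simp] lemma wordEval_cons (g : α → G) (u : FreeMagma α) (l : List (FreeMagma α)) :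
    wordEval g (u :: l) = treeEval g u * wordEval g l := by simp [wordEval]

@[simp] lemma wordEval_append (g : α → G) (l l' : List (FreeMagma α)) :
    wordEval g (l ++ l') = wordEval g l * wordEval g l' := by simp [wordEval]

/-- The total mass of a word, where a letter of weight `j` has mass `ρ ^ j`. -/
noncomputable def mass (ρ : ℝ) (l : List (FreeMagma α)) : ℝ :=
  (l.map fun u => ρ ^ u.length).sum

@[simp] lemma mass_nil (ρ : ℝ) : mass ρ ([] : List (FreeMagma α)) = 0 := rfl

@[simp] lemma mass_cons (ρ : ℝ) (u : FreeMagma α) (l : List (FreeMagma α)) :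
    mass ρ (u :: l) = ρ ^ u.length + mass ρ l := by simp [mass]

@[simp] lemma mass_append (ρ : ℝ) (l l' : List (FreeMagma α)) :
    mass ρ (l ++ l') = mass ρ l + mass ρ l' := by simp [mass]

lemma mass_nonneg {ρ : ℝ} (hρ : 0 ≤ ρ) (l : List (FreeMagma α)) : 0 ≤ mass ρ l := by
  induction l with
  | nil => simp
  | cons u l ih => simp; positivity

/-- A word representing the conjugate of a word by a letter. -/
def conjLetter (c : FreeMagma α) (l : List (FreeMagma α)) : List (FreeMagma α) :=
  l.flatMap fun t => [t, t * c]

@[simp] lemma conjLetter_nil (c : FreeMagma α) : conjLetter c [] = [] := rfl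

@[simp] lemma conjLetter_cons (c u : FreeMagma α) (l : List (FreeMagma α)) :
    conjLetter c (u :: l) = u :: u * c :: conjLetter c l := rfl

lemma wordEval_conjLetter (g : α → G) (c : FreeMagma α) (l : List (FreeMagma α)) :
    wordEval g (conjLetter c l) = (treeEval g c)⁻¹ * wordEval g l * treeEval g c := by
  induction l with
  | nil => simp
  | cons u l ih => simp [ih]; group

lemma mass_conjLetter (ρ : ℝ) (c : FreeMagma α) (l : List (FreeMagma α)) :
    mass ρ (conjLetter c l) = mass ρ l * (1 + ρ ^ c.length) := by
  induction l with
  | nil => simp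
  | cons u l ih => simp [ih, FreeMagma.length, pow_add]; ring

lemma mem_conjLetter {c t : FreeMagma α} {l : List (FreeMagma α)} (h : t ∈ conjLetter c l) :
    t ∈ l ∨ ∃ u ∈ l, u.length < t.length := by
  simp only [conjLetter, List.mem_flatMap, List.mem_cons, List.not_mem_nil, or_false] at h
  obtain ⟨u, hu, rfl | rfl⟩ := h
  · exact Or.inl hu
  · exact Or.inr ⟨u, hu, by have := FreeMagma.length_pos c; simp [FreeMagma.length]; omega⟩

/-- A word representing the conjugate of a word by another word. -/
def conjWord (q l : List (FreeMagma α)) : List (FreeMagma α) :=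
  q.foldl (fun l c => conjLetter c l) l

@[simp] lemma conjWord_nil (l : List (FreeMagma α)) : conjWord [] l = l := rfl

@[simp] lemma conjWord_cons (c : FreeMagma α) (q l : List (FreeMagma α)) :
    conjWord (c :: q) l = conjWord q (conjLetter c l) := rfl

lemma wordEval_conjWord (g : α → G) (q l : List (FreeMagma α)) :
    wordEval g (conjWord q l) = (wordEval g q)⁻¹ * wordEval g l * wordEval g q := by
  induction q generalizing l with
  | nil => simp
  | cons c q ih => simp [ih, wordEval_conjLetter]; group

lemma mass_conjWord_replicate (ρ : ℝ) (n : ℕ) (c : FreeMagma α) (l : List (FreeMagma α)) :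
    mass ρ (conjWord (List.replicate n c) l) = mass ρ l * (1 + ρ ^ c.length) ^ n := by
  induction n generalizing l with
  | zero => simp
  | succ n ih => simp [List.replicate_succ, ih, mass_conjLetter]; ring

lemma mass_conjWord_le {ρ : ℝ} (hρ : 0 ≤ ρ) (q l : List (FreeMagma α)) :
    mass ρ (conjWord q l) ≤ mass ρ l * Real.exp (mass ρ q) := by
  induction q generalizing l with
  | nil => simp
  | cons c q ih =>
    refine (ih _).trans ?_
    rw [mass_conjLetter, mass_cons, Real.exp_add, mul_assoc]
    have := mass_nonneg hρ l
    gcongr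
    linarith [Real.add_one_le_exp (ρ ^ c.length)]

lemma mem_conjWord {q l : List (FreeMagma α)} {t : FreeMagma α} (h : t ∈ conjWord q l) :
    t ∈ l ∨ ∃ u ∈ l, u.length < t.length := by
  induction q generalizing l with
  | nil => exact Or.inl h
  | cons c q ih =>
    rcases ih h with h | ⟨u, hu, hut⟩
    · exact mem_conjLetter h
    · rcases mem_conjLetter hu with hu | ⟨v, hv, hvu⟩
      · exact Or.inr ⟨u, hu, hut⟩
      · exact Or.inr ⟨v, hv, hvu.trans hut⟩

open scoped Classical in
lemma count_conjWord {τ : FreeMagma α} {q l : List (FreeMagma α)}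
    (h : ∀ u ∈ l, τ.length ≤ u.length) : (conjWord q l).count τ = l.count τ := by
  induction q generalizing l with
  | nil => rfl
  | cons c q ih =>
    rw [conjWord_cons, ih]
    · clear ih
      induction l with
      | nil => rfl
      | cons u l ih =>
        have hne : u * c ≠ τ := by
          intro he
          have := h u (by simp)
          have h2 := FreeMagma.length_pos c
          rw [← he] at this
          simp [FreeMagma.length] at this
          omega
        rw [conjLetter_cons, List.count_cons, List.count_cons_of_ne hne,
          ih (fun v hv => h v (by simp [hv])), List.count_cons]
    · intro u hu
      rcases mem_conjLetter hu with hu | ⟨v, hv, hvu⟩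
      · exact h u hu
      · exact (h v hv).trans hvu.le

open scoped Classical in
/-- Collecting all occurrences of a letter of minimal weight to the left. -/
lemma exists_collect (g : α → G) {ρ : ℝ} (hρ : 0 ≤ ρ) (c : FreeMagma α)
    (l : List (FreeMagma α)) (h : ∀ u ∈ l, c.length ≤ u.length) :
    ∃ l', wordEval g l = treeEval g c ^ l.count c * wordEval g l' ∧ c ∉ l' ∧
      (∀ t ∈ l', t ∈ l ∨ c.length < t.length) ∧
      mass ρ l' ≤ mass ρ l * (1 + ρ ^ c.length) ^ l.count c := by
  induction l with
  | nil => exact ⟨[], by simp⟩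
  | cons u l ih =>
    obtain ⟨l', he, hc, hl, hm⟩ := ih fun v hv => h v (by simp [hv])
    have h1 : 1 ≤ 1 + ρ ^ c.length := by have := pow_nonneg hρ c.length; linarith
    have hnn := mass_nonneg hρ l
    have hu0 := pow_nonneg hρ u.length
    by_cases huc : u = c
    · subst huc
      refine ⟨l', by simp [he, pow_succ', mul_assoc], hc, fun t ht => ?_, ?_⟩
      · rcases hl t ht with h | h
        · exact Or.inl (by simp [h])
        · exact Or.inr h
      · refine hm.trans ?_
        simp only [List.count_cons_self, mass_cons]
        gcongr
        · linarith
        · omega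
    · refine ⟨conjWord (List.replicate (l.count c) c) [u] ++ l', ?_, ?_, ?_, ?_⟩
      · rw [wordEval_append, wordEval_conjWord, List.count_cons_of_ne huc, wordEval_cons, he]
        simp [wordEval]
        group
      · rw [List.mem_append, not_or]
        refine ⟨fun hmem => ?_, hc⟩
        rcases mem_conjWord hmem with h' | ⟨v, hv, hvc⟩
        · simp at h'; exact huc h'.symm
        · simp at hv; subst hv
          have := h v (by simp)
          omega
      · intro t ht
        rcases List.mem_append.1 ht with ht | ht
        · rcases mem_conjWord ht with h' | ⟨v, hv, hvc⟩
          · simp at h'; simp [h']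
          · simp at hv; subst hv
            exact Or.inr ((h v (by simp)).trans_lt hvc)
        · rcases hl t ht with h | h
          · exact Or.inl (by simp [h])
          · exact Or.inr h
      · rw [mass_append, mass_conjWord_replicate, List.count_cons_of_ne huc]
        simp only [mass_cons, mass_nil]
        nlinarith

open scoped Classical in
lemma count_mul_le_mass {ρ : ℝ} (hρ : 0 ≤ ρ) (c : FreeMagma α) (l : List (FreeMagma α)) :
    l.count c * ρ ^ c.length ≤ mass ρ l := by
  induction l with
  | nil => simp
  | cons u l ih =>
    by_cases huc : u = c
    · subst huc; simp; linarith
    · rw [List.count_cons_of_ne huc, mass_cons]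
      have := pow_nonneg hρ u.length
      linarith

open scoped Classical in
lemma mass_collect_le {ρ : ℝ} (hρ : 0 ≤ ρ) (c : FreeMagma α) (l : List (FreeMagma α)) :
    mass ρ l * (1 + ρ ^ c.length) ^ l.count c ≤ mass ρ l * Real.exp (mass ρ l) := by
  have := mass_nonneg hρ l
  gcongr
  calc (1 + ρ ^ c.length) ^ l.count c ≤ Real.exp (ρ ^ c.length) ^ l.count c := by
        have := pow_nonneg hρ c.length
        gcongr
        linarith [Real.add_one_le_exp (ρ ^ c.length)]
    _ = Real.exp (l.count c * ρ ^ c.length) := by rw [← Real.exp_nat_mul]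
    _ ≤ _ := Real.exp_le_exp.2 (count_mul_le_mass hρ c l)

/-- A word representing the commutator of a letter and a word. -/
def letterComm (u : FreeMagma α) : List (FreeMagma α) → List (FreeMagma α)
  | [] => []
  | v :: Y => letterComm u Y ++ conjWord Y [u * v]

/-- A word representing the commutator of two words. -/
def wordComm : List (FreeMagma α) → List (FreeMagma α) → List (FreeMagma α)
  | [], _ => []
  | u :: X, Y => conjWord X (letterComm u Y) ++ wordComm X Y

lemma wordEval_letterComm (g : α → G) (u : FreeMagma α) (Y : List (FreeMagma α)) :
    wordEval g (letterComm u Y) =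
      (treeEval g u)⁻¹ * (wordEval g Y)⁻¹ * treeEval g u * wordEval g Y := by
  induction Y with
  | nil => simp [letterComm]
  | cons v Y ih => simp [letterComm, ih, wordEval_conjWord]; group

lemma wordEval_wordComm (g : α → G) (X Y : List (FreeMagma α)) :
    wordEval g (wordComm X Y) =
      (wordEval g X)⁻¹ * (wordEval g Y)⁻¹ * wordEval g X * wordEval g Y := by
  induction X with
  | nil => simp [wordComm]
  | cons u X ih => simp [wordComm, ih, wordEval_conjWord, wordEval_letterComm]; group

lemma mass_letterComm_le {ρ : ℝ} (hρ : 0 ≤ ρ) (u : FreeMagma α) (Y : List (FreeMagma α)) :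
    mass ρ (letterComm u Y) ≤ ρ ^ u.length * mass ρ Y * Real.exp (mass ρ Y) := by
  have hu := pow_nonneg hρ u.length
  induction Y with
  | nil => simp [letterComm]
  | cons v Y ih =>
    have hv := pow_nonneg hρ v.length
    have hY := mass_nonneg hρ Y
    have h1 := mass_conjWord_le hρ Y [u * v]
    have h2 : Real.exp (mass ρ Y) ≤ Real.exp (ρ ^ v.length + mass ρ Y) := by gcongr; linarith
    simp only [letterComm, mass_append, mass_cons, mass_nil, FreeMagma.length, pow_add,
      add_zero] at h1 ⊢
    calc _ ≤ ρ ^ u.length * mass ρ Y * Real.exp (mass ρ Y) +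
          ρ ^ u.length * ρ ^ v.length * Real.exp (mass ρ Y) := by linarith
      _ = ρ ^ u.length * (ρ ^ v.length + mass ρ Y) * Real.exp (mass ρ Y) := by ring
      _ ≤ _ := by gcongr

lemma mass_wordComm_le {ρ : ℝ} (hρ : 0 ≤ ρ) (X Y : List (FreeMagma α)) :
    mass ρ (wordComm X Y) ≤ mass ρ X * mass ρ Y * Real.exp (mass ρ X + mass ρ Y) := by
  have hY := mass_nonneg hρ Y
  induction X with
  | nil => simp [wordComm]
  | cons u X ih =>
    have hu := pow_nonneg hρ u.length
    have hX := mass_nonneg hρ X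
    have h1 := mass_conjWord_le hρ X (letterComm u Y)
    have h3 := mass_letterComm_le hρ u Y
    simp only [wordComm, mass_append, mass_cons]
    calc _ ≤ ρ ^ u.length * mass ρ Y * Real.exp (mass ρ Y) * Real.exp (mass ρ X) +
          mass ρ X * mass ρ Y * Real.exp (mass ρ X + mass ρ Y) := by
          refine add_le_add (h1.trans ?_) ih
          gcongr
      _ = (ρ ^ u.length + mass ρ X) * mass ρ Y * Real.exp (mass ρ X + mass ρ Y) := by
          rw [Real.exp_add]; ring
      _ ≤ _ := by gcongr; linarith

/-- Every letter of the word is `τ` or heavier than `τ`. -/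
def LeadsWith (τ : FreeMagma α) (l : List (FreeMagma α)) : Prop :=
  ∀ u ∈ l, u = τ ∨ τ.length < u.length

lemma LeadsWith.length_le {τ : FreeMagma α} {l : List (FreeMagma α)} (h : LeadsWith τ l) :
    ∀ u ∈ l, τ.length ≤ u.length := fun u hu => by
  rcases h u hu with rfl | h
  · exact le_rfl
  · exact h.le

lemma LeadsWith.append {τ : FreeMagma α} {l l' : List (FreeMagma α)} (h : LeadsWith τ l)
    (h' : LeadsWith τ l') : LeadsWith τ (l ++ l') := fun u hu =>
  (List.mem_append.1 hu).elim (h u) (h' u)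

lemma LeadsWith.conjWord {τ : FreeMagma α} {l : List (FreeMagma α)} (h : LeadsWith τ l)
    (q : List (FreeMagma α)) : LeadsWith τ (conjWord q l) := fun u hu => by
  rcases mem_conjWord hu with hu | ⟨v, hv, hvu⟩
  · exact h u hu
  · exact Or.inr ((h.length_le v hv).trans_lt hvu)

lemma leadsWith_singleton_mul {x y u v : FreeMagma α} (hu : u = x ∨ x.length < u.length)
    (hv : v = y ∨ y.length < v.length) : LeadsWith (x * y) [u * v] := by
  intro t ht
  simp only [List.mem_cons, List.not_mem_nil, or_false] at ht
  subst ht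
  rcases hu with rfl | hu <;> rcases hv with rfl | hv
  · exact Or.inl rfl
  all_goals right; simp [FreeMagma.length]; try omega

lemma leadsWith_letterComm {x y u : FreeMagma α} {Y : List (FreeMagma α)}
    (hu : u = x ∨ x.length < u.length) (hY : LeadsWith y Y) :
    LeadsWith (x * y) (letterComm u Y) := by
  induction Y with
  | nil => simp [LeadsWith, letterComm]
  | cons v Y ih =>
    exact (ih fun w hw => hY w (by simp [hw])).append
      ((leadsWith_singleton_mul hu (hY v (by simp))).conjWord Y)

lemma leadsWith_wordComm {x y : FreeMagma α} {X Y : List (FreeMagma α)}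
    (hX : LeadsWith x X) (hY : LeadsWith y Y) : LeadsWith (x * y) (wordComm X Y) := by
  induction X with
  | nil => simp [LeadsWith, wordComm]
  | cons u X ih =>
    exact ((leadsWith_letterComm (hX u (by simp)) hY).conjWord X).append
      (ih fun w hw => hX w (by simp [hw]))

lemma mul_tree_inj {x y u v : FreeMagma α} : u * v = x * y ↔ u = x ∧ v = y := by
  refine ⟨fun h => ?_, fun ⟨hu, hv⟩ => hu ▸ hv ▸ rfl⟩
  rw [← FreeMagma.mul_eq, ← FreeMagma.mul_eq] at h
  cases h
  exact ⟨rfl, rfl⟩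

open scoped Classical in
lemma count_letterComm {x y u : FreeMagma α} {Y : List (FreeMagma α)}
    (hu : u = x ∨ x.length < u.length) (hY : LeadsWith y Y) :
    (letterComm u Y).count (x * y) = if u = x then Y.count y else 0 := by
  induction Y with
  | nil => simp [letterComm]
  | cons v Y ih =>
    rw [letterComm, List.count_append, ih fun w hw => hY w (by simp [hw]),
      count_conjWord (leadsWith_singleton_mul hu (hY v (by simp))).length_le]
    by_cases h1 : u = x <;> by_cases h2 : v = y <;> simp [mul_tree_inj, h1, h2]

open scoped Classical in
lemma count_wordComm {x y : FreeMagma α} {X Y : List (FreeMagma α)}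
    (hX : LeadsWith x X) (hY : LeadsWith y Y) :
    (wordComm X Y).count (x * y) = X.count x * Y.count y := by
  induction X with
  | nil => simp [wordComm]
  | cons u X ih =>
    rw [wordComm, List.count_append, ih fun w hw => hX w (by simp [hw]),
      count_conjWord (leadsWith_letterComm (hX u (by simp)) hY).length_le,
      count_letterComm (hX u (by simp)) hY]
    by_cases h1 : u = x <;> simp [h1]
    ring

end Collection

section Doubling

variable {G α : Type*} [Group G]

/-- The elements of `G` spelled by words of length at most `n` in the letters `α`. -/
def wordBall (g : α → G) (n : ℕ) : Set G := {x | ∃ p : List α, p.length ≤ n ∧ (p.map g).prod = x}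

lemma wordBall_mono (g : α → G) {m n : ℕ} (h : m ≤ n) : wordBall g m ⊆ wordBall g n :=
  fun _ ⟨p, hp, he⟩ => ⟨p, hp.trans h, he⟩

lemma one_mem_wordBall (g : α → G) (n : ℕ) : (1 : G) ∈ wordBall g n := ⟨[], by simp⟩

lemma mul_mem_wordBall {g : α → G} {m n : ℕ} {x y : G} (hx : x ∈ wordBall g m)
    (hy : y ∈ wordBall g n) : x * y ∈ wordBall g (m + n) := by
  obtain ⟨p, hp, rfl⟩ := hx
  obtain ⟨q, hq, rfl⟩ := hy
  exact ⟨p ++ q, by simp; omega, by simp⟩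

lemma inv_mem_wordBall {g : α → G} (hinv : ∀ a, ∃ b, g b = (g a)⁻¹) {n : ℕ} {x : G}
    (hx : x ∈ wordBall g n) : x⁻¹ ∈ wordBall g n := by
  choose inv hinv using hinv
  obtain ⟨p, hp, rfl⟩ := hx
  refine ⟨(p.map inv).reverse, by simpa using hp, ?_⟩
  rw [List.prod_inv_reverse]
  simp [List.map_reverse, Function.comp_def, hinv]

lemma wordBall_finite [Finite α] (g : α → G) (n : ℕ) : (wordBall g n).Finite := by
  have h : {p : List α | p.length ≤ n}.Finite := List.finite_length_le α n
  refine (h.image fun p => (p.map g).prod).subset ?_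
  rintro x ⟨p, hp, rfl⟩
  exact ⟨p, hp, rfl⟩

lemma wordEval_map_of (g : α → G) (p : List α) :
    wordEval g (p.map FreeMagma.of) = (p.map g).prod := by
  simp [wordEval, Function.comp_def]

lemma mass_map_of (ρ : ℝ) (p : List α) : mass ρ (p.map FreeMagma.of) = p.length * ρ := by
  induction p with
  | nil => simp
  | cons a p ih => simp [ih, FreeMagma.length]; ring

lemma mass_replicate (ρ : ℝ) (n : ℕ) (τ : FreeMagma α) :
    mass ρ (List.replicate n τ) = n * ρ ^ τ.length := by
  simp [mass]

open scoped Classical in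
/-- The powers `τ ^ a` with `a ≤ m ^ τ.length` are, up to heavier letters, represented by words of
length `O(m)` in the generators. -/
lemma exists_leadsWith (g : α → G) (hinv : ∀ a, ∃ b, g b = (g a)⁻¹) (τ : FreeMagma α) :
    ∃ K : ℕ, ∀ m : ℕ, 1 ≤ m → ∀ a ≤ m ^ τ.length, ∃ l, LeadsWith τ l ∧ l.count τ = a ∧
      mass (1 / m) l ≤ K ∧ wordEval g l ∈ wordBall g (K * m) := by
  induction τ with
  | ih1 i =>
    refine ⟨1, fun m hm a ha => ⟨List.replicate a (.of i), fun u hu => ?_, by simp, ?_, ?_⟩⟩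
    · exact Or.inl (List.eq_of_mem_replicate hu)
    · have hm' : (0 : ℝ) < m := by exact_mod_cast hm
      simp only [FreeMagma.length, pow_one] at ha
      rw [mass_replicate]
      simp only [FreeMagma.length, pow_one, Nat.cast_one]
      rw [mul_one_div, div_le_one hm']
      exact_mod_cast ha
    · simp only [FreeMagma.length, pow_one] at ha
      refine ⟨List.replicate a i, by simpa using ha, ?_⟩
      rw [← wordEval_map_of, List.map_replicate]
  | ih2 x y ihx ihy =>
    obtain ⟨Kx, hx⟩ := ihx
    obtain ⟨Ky, hy⟩ := ihy
    have key : ∀ m : ℕ, 1 ≤ m → ∀ a ≤ m ^ x.length, ∀ b ≤ m ^ y.length, ∃ l,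
        LeadsWith (x * y) l ∧ l.count (x * y) = a * b ∧
        mass (1 / m) l ≤ Kx * Ky * Real.exp (Kx + Ky) ∧
        wordEval g l ∈ wordBall g (Kx * m + Ky * m + Kx * m + Ky * m) := by
      intro m hm a ha b hb
      obtain ⟨X, hX, rfl, hXm, hXb⟩ := hx m hm a ha
      obtain ⟨Y, hY, rfl, hYm, hYb⟩ := hy m hm b hb
      have hX0 := mass_nonneg (ρ := 1 / (m : ℝ)) (by positivity) X
      have hY0 := mass_nonneg (ρ := 1 / (m : ℝ)) (by positivity) Y
      refine ⟨wordComm X Y, leadsWith_wordComm hX hY, count_wordComm hX hY, ?_, ?_⟩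
      · refine (mass_wordComm_le (by positivity) X Y).trans ?_
        gcongr
      · rw [wordEval_wordComm]
        exact mul_mem_wordBall (mul_mem_wordBall (mul_mem_wordBall (inv_mem_wordBall hinv hXb)
          (inv_mem_wordBall hinv hYb)) hXb) hYb
    obtain ⟨M, hM⟩ := exists_nat_ge (2 * (Kx * Ky * Real.exp (Kx + Ky)))
    refine ⟨M + 4 * Kx + 4 * Ky, fun m hm a ha => ?_⟩
    have hmy : 0 < m ^ y.length := by positivity
    have h1 : a / m ^ y.length ≤ m ^ x.length := by
      rw [show (x * y).length = x.length + y.length from rfl, pow_add] at ha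
      exact Nat.div_le_of_le_mul (by rwa [mul_comm])
    obtain ⟨l₁, hl₁, hc₁, hm₁, hb₁⟩ := key m hm _ h1 _ le_rfl
    obtain ⟨l₂, hl₂, hc₂, hm₂, hb₂⟩ := key m hm 1 (Nat.one_le_pow _ _ hm)
      (a % m ^ y.length) (Nat.mod_lt _ hmy).le
    refine ⟨l₁ ++ l₂, hl₁.append hl₂, ?_, ?_, ?_⟩
    · rw [List.count_append, hc₁, hc₂, one_mul, Nat.div_add_mod']
    · rw [mass_append]
      push_cast
      have : (0 : ℝ) ≤ Kx := by positivity
      have : (0 : ℝ) ≤ Ky := by positivity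
      linarith
    · rw [wordEval_append]
      refine wordBall_mono g ?_ (mul_mem_wordBall hb₁ hb₂)
      nlinarith [Nat.zero_le (M * m)]

/-- The letters of the word lie in `U` or have weight more than `c`. -/
def WordOn (c : ℕ) (U : Finset (FreeMagma α)) (l : List (FreeMagma α)) : Prop :=
  ∀ u ∈ l, u ∈ U ∨ c < u.length

/-- Every tree of weight at most `c` heavier than an element of `U` is in `U`. -/
def UpClosed (c : ℕ) (U : Finset (FreeMagma α)) : Prop :=
  ∀ τ ∈ U, ∀ σ : FreeMagma α, τ.length < σ.length → σ.length ≤ c → σ ∈ U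

lemma wordEval_eq_one {g : α → G} {c : ℕ}
    (hc : ∀ τ : FreeMagma α, c < τ.length → treeEval g τ = 1) {l : List (FreeMagma α)}
    (hl : WordOn c ∅ l) : wordEval g l = 1 := by
  refine List.prod_eq_one fun x hx => ?_
  obtain ⟨u, hu, rfl⟩ := List.mem_map.1 hx
  exact hc u (by simpa using hl u hu)

open scoped Classical in
lemma UpClosed.erase {c : ℕ} {U : Finset (FreeMagma α)} (hU : UpClosed c U) {τ : FreeMagma α}
    (hτ : ∀ σ ∈ U, τ.length ≤ σ.length) : UpClosed c (U.erase τ) := by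
  intro u hu σ hσ hσc
  rw [Finset.mem_erase] at hu ⊢
  exact ⟨fun h => absurd (hτ u hu.2) (by rw [h] at hσ; omega), hU u hu.2 σ hσ hσc⟩

open scoped Classical in
lemma exists_collect_wordOn (g : α → G) {c : ℕ} {U : Finset (FreeMagma α)} (hU : UpClosed c U)
    {τ : FreeMagma α} (hτU : τ ∈ U) (hτc : τ.length ≤ c) (hτ : ∀ σ ∈ U, τ.length ≤ σ.length)
    {ρ : ℝ} (hρ : 0 ≤ ρ) {l : List (FreeMagma α)} (hl : WordOn c U l) :
    ∃ l', wordEval g l = treeEval g τ ^ l.count τ * wordEval g l' ∧ WordOn c (U.erase τ) l' ∧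
      mass ρ l' ≤ mass ρ l * Real.exp (mass ρ l) := by
  obtain ⟨l', he, hτ', hl', hm⟩ := exists_collect g hρ τ l fun u hu => by
    rcases hl u hu with h | h
    · exact hτ u h
    · omega
  refine ⟨l', he, fun u hu => ?_, hm.trans (mass_collect_le hρ τ l)⟩
  have hne : u ≠ τ := fun h => hτ' (h ▸ hu)
  rcases le_or_gt u.length c with huc | huc
  · refine Or.inl (Finset.mem_erase.2 ⟨hne, ?_⟩)
    rcases hl' u hu with h | h
    · exact (hl u h).resolve_right (by omega)
    · exact hU τ hτU u h huc
  · exact Or.inr huc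

open scoped Classical in
lemma exists_wordEval_mem_wordBall (g : α → G) (hinv : ∀ a, ∃ b, g b = (g a)⁻¹) {c : ℕ}
    (hc : ∀ τ : FreeMagma α, c < τ.length → treeEval g τ = 1) (U : Finset (FreeMagma α))
    (hU : UpClosed c U) (hUc : ∀ τ ∈ U, τ.length ≤ c) (K : ℝ) :
    ∃ C : ℕ, ∀ m : ℕ, 1 ≤ m → ∀ l, WordOn c U l → mass (1 / m) l ≤ K →
      wordEval g l ∈ wordBall g (C * m) := by
  induction hn : U.card generalizing U K with
  | zero =>
    rw [Finset.card_eq_zero] at hn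
    subst hn
    exact ⟨0, fun m _ l hl _ => by rw [wordEval_eq_one hc hl]; exact one_mem_wordBall g _⟩
  | succ n ih =>
    have hne : U.Nonempty := Finset.card_pos.1 (by omega)
    obtain ⟨τ, hτU, hτ⟩ := U.exists_min_image FreeMagma.length hne
    have ih' := fun K => ih (U.erase τ) (hU.erase hτ)
      (fun σ hσ => hUc σ (Finset.mem_of_mem_erase hσ)) K (by rw [Finset.card_erase_of_mem hτU]; omega)
    obtain ⟨A, hA⟩ := exists_leadsWith g hinv τ
    obtain ⟨N, hN⟩ := exists_nat_ge (max K 1)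
    have hN1 : 1 ≤ N := by
      have := (le_max_right K 1).trans hN
      exact_mod_cast this
    have hKN := (le_max_left K 1).trans hN
    obtain ⟨C₁, hC₁⟩ := ih' (N * Real.exp N)
    obtain ⟨C₂, hC₂⟩ := ih' (A * Real.exp A)
    refine ⟨A * N + C₂ * N + C₁, fun m hm l hl hlm => ?_⟩
    have hm0 : (0 : ℝ) < m := by exact_mod_cast hm
    have hτ1 := FreeMagma.length_pos τ
    obtain ⟨l₁, he₁, hl₁, hm₁⟩ :=
      exists_collect_wordOn g hU hτU (hUc τ hτU) hτ (ρ := 1 / (m : ℝ)) (by positivity) hl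
    have hl0 := mass_nonneg (ρ := 1 / (m : ℝ)) (by positivity) l
    have hb₁ := hC₁ m hm l₁ hl₁ (hm₁.trans (by gcongr <;> linarith))
    have hcount : l.count τ ≤ (N * m) ^ τ.length := by
      have h1 := (count_mul_le_mass (ρ := 1 / (m : ℝ)) (by positivity) τ l).trans
        (hlm.trans hKN)
      rw [div_pow, one_pow, mul_one_div, div_le_iff₀ (by positivity)] at h1
      have h2 : (N : ℝ) * m ^ τ.length ≤ (N : ℝ) ^ τ.length * m ^ τ.length := by
        gcongr
        exact le_self_pow₀ (by exact_mod_cast hN1) (by omega)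
      rw [← mul_pow] at h2
      exact_mod_cast h1.trans h2
    have hNm : 1 ≤ N * m := Nat.one_le_iff_ne_zero.2 (by positivity)
    obtain ⟨l₂, hl₂, hcl₂, hml₂, hbl₂⟩ := hA (N * m) hNm _ hcount
    have hl₂on : WordOn c U l₂ := fun u hu => by
      rcases hl₂ u hu with rfl | h
      · exact Or.inl hτU
      · rcases le_or_gt u.length c with huc | huc
        · exact Or.inl (hU τ hτU u h huc)
        · exact Or.inr huc
    have hl20 := mass_nonneg (ρ := 1 / ((N * m : ℕ) : ℝ)) (by positivity) l₂
    obtain ⟨l₃, he₃, hl₃, hm₃⟩ :=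
      exists_collect_wordOn g hU hτU (hUc τ hτU) hτ (ρ := 1 / ((N * m : ℕ) : ℝ)) (by positivity)
        hl₂on
    have hb₃ := hC₂ (N * m) hNm l₃ hl₃ (hm₃.trans (by gcongr))
    have : wordEval g l = wordEval g l₂ * (wordEval g l₃)⁻¹ * wordEval g l₁ := by
      rw [he₁, he₃, hcl₂]; group
    rw [this]
    refine wordBall_mono g ?_ (mul_mem_wordBall (mul_mem_wordBall hbl₂
      (inv_mem_wordBall hinv hb₃)) hb₁)
    apply le_of_eq; ring

lemma finite_length_le [Finite α] (c : ℕ) : {τ : FreeMagma α | τ.length ≤ c}.Finite := by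
  induction c with
  | zero =>
    convert Set.finite_empty
    ext τ
    simpa using (FreeMagma.length_pos τ).ne'
  | succ c ih =>
    refine ((Set.finite_range FreeMagma.of).union (Set.Finite.image2 (· * ·) ih ih)).subset ?_
    rintro (a | ⟨x, y⟩) h
    · exact Or.inl ⟨a, rfl⟩
    · refine Or.inr ⟨x, ?_, y, ?_, rfl⟩
      all_goals
        have h1 := FreeMagma.length_pos x
        have h2 := FreeMagma.length_pos y
        simp only [Set.mem_ofPred_eq, FreeMagma.length] at h ⊢
        omega

open scoped Classical in
/-- Words of bounded mass at scale `n` are covered by boundedly many translates of a ball. -/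
lemma exists_cover (g : α → G) (hinv : ∀ a, ∃ b, g b = (g a)⁻¹) {c C : ℕ}
    (hc : ∀ τ : FreeMagma α, c < τ.length → treeEval g τ = 1)
    (hC : ∀ n : ℕ, 1 ≤ n → ∀ τ : FreeMagma α, ∀ a ≤ n ^ τ.length,
      treeEval g τ ^ a ∈ wordBall g (C * n))
    (U : Finset (FreeMagma α)) (hU : UpClosed c U) (hUc : ∀ τ ∈ U, τ.length ≤ c) (K : ℝ) :
    ∃ M : ℕ, ∀ n : ℕ, 1 ≤ n → ∃ X : Finset G, X.card ≤ M ∧ ∀ l, WordOn c U l →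
      mass (1 / n) l ≤ K → ∃ x ∈ X, ∃ y ∈ wordBall g (U.card * C * n), wordEval g l = x * y := by
  induction hn : U.card generalizing U K with
  | zero =>
    rw [Finset.card_eq_zero] at hn
    subst hn
    exact ⟨1, fun n _ => ⟨{1}, by simp, fun l hl _ => ⟨1, by simp, 1, one_mem_wordBall g _, by
      rw [wordEval_eq_one hc hl, one_mul]⟩⟩⟩
  | succ k ih =>
    have hne : U.Nonempty := Finset.card_pos.1 (by omega)
    obtain ⟨τ, hτU, hτ⟩ := U.exists_min_image FreeMagma.length hne
    obtain ⟨N, hN⟩ := exists_nat_ge K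
    obtain ⟨M, hM⟩ := ih (U.erase τ) (hU.erase hτ)
      (fun σ hσ => hUc σ (Finset.mem_of_mem_erase hσ)) (N * Real.exp N * Real.exp C)
      (by rw [Finset.card_erase_of_mem hτU]; omega)
    refine ⟨(N + 1) * M, fun n hn1 => ?_⟩
    have hn0 : (0 : ℝ) < n := by exact_mod_cast hn1
    obtain ⟨X, hXc, hX⟩ := hM n hn1
    refine ⟨Finset.image₂ (fun b x => treeEval g τ ^ (b * n ^ τ.length) * x)
      (Finset.range (N + 1)) X, ?_, fun l hl hlm => ?_⟩
    · refine (Finset.card_image₂_le _ _ _).trans ?_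
      rw [Finset.card_range]
      gcongr
    obtain ⟨l₁, he₁, hl₁, hm₁⟩ :=
      exists_collect_wordOn g hU hτU (hUc τ hτU) hτ (ρ := 1 / (n : ℝ)) (by positivity) hl
    have hl0 := mass_nonneg (ρ := 1 / (n : ℝ)) (by positivity) l
    have hb : l.count τ / n ^ τ.length ≤ N := by
      have h1 := (count_mul_le_mass (ρ := 1 / (n : ℝ)) (by positivity) τ l).trans
        (hlm.trans hN)
      rw [div_pow, one_pow, mul_one_div, div_le_iff₀ (by positivity)] at h1
      refine Nat.div_le_of_le_mul ?_
      rw [mul_comm]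
      exact_mod_cast h1
    have hu := hC n hn1 τ (l.count τ % n ^ τ.length) (Nat.mod_lt _ (by positivity)).le
    obtain ⟨p, hp, hpe⟩ := inv_mem_wordBall hinv hu
    rw [← wordEval_map_of] at hpe
    obtain ⟨x, hx, y, hy, hxy⟩ := hX (conjWord (p.map .of) l₁) (fun v hv => by
        rcases le_or_gt v.length c with hvc | hvc
        · left
          rcases mem_conjWord hv with h | ⟨w, hw, hwv⟩
          · exact (hl₁ v h).resolve_right (by omega)
          · exact (hU.erase hτ) w ((hl₁ w hw).resolve_right (by omega)) v hwv hvc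
        · exact Or.inr hvc) (by
      refine (mass_conjWord_le (by positivity) _ _).trans ?_
      have hpC : mass (1 / (n : ℝ)) (p.map .of) ≤ C := by
        rw [mass_map_of, mul_one_div, div_le_iff₀ hn0]
        exact_mod_cast hp
      have := mass_nonneg (ρ := 1 / (n : ℝ)) (by positivity) l₁
      have : mass (1 / (n : ℝ)) l ≤ N := hlm.trans hN
      gcongr
      refine hm₁.trans ?_
      gcongr)
    rw [wordEval_conjWord, hpe] at hxy
    refine ⟨_, Finset.mem_image₂_of_mem (Finset.mem_range.2 (Nat.lt_succ_of_le hb)) hx,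
      y * treeEval g τ ^ (l.count τ % n ^ τ.length), ?_, ?_⟩
    · refine wordBall_mono g ?_ (mul_mem_wordBall hy hu)
      apply le_of_eq; ring
    · have h2 : treeEval g τ ^ l.count τ = treeEval g τ ^ (l.count τ / n ^ τ.length * n ^ τ.length)
          * treeEval g τ ^ (l.count τ % n ^ τ.length) := by
        rw [← pow_add, Nat.div_add_mod']
      rw [he₁, h2]
      rw [inv_inv, mul_inv_eq_iff_eq_mul] at hxy
      rw [mul_assoc, hxy]
      group

/-- In a group where heavy commutators of the generators vanish, balls are doubling. -/
lemma exists_doubling_of_treeEval [Finite α] (g : α → G) (hinv : ∀ a, ∃ b, g b = (g a)⁻¹) {c : ℕ}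
    (hc : ∀ τ : FreeMagma α, c < τ.length → treeEval g τ = 1) :
    ∃ M : ℕ, ∀ r : ℕ, 1 ≤ r → (wordBall g (2 * r)).ncard ≤ M * (wordBall g r).ncard := by
  classical
  set U := (finite_length_le (α := α) c).toFinset with hUdef
  have hmem : ∀ τ : FreeMagma α, τ ∈ U ↔ τ.length ≤ c := by simp [hUdef]
  have hU : UpClosed c U := fun _ _ σ _ h => (hmem σ).2 h
  have hUc : ∀ τ ∈ U, τ.length ≤ c := fun τ h => (hmem τ).1 h
  have hon : ∀ l, WordOn c U l := fun l u _ => by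
    rw [hmem]; exact le_or_gt _ _
  obtain ⟨C, hC⟩ := exists_wordEval_mem_wordBall g hinv hc U hU hUc 1
  have hC' : ∀ n : ℕ, 1 ≤ n → ∀ τ : FreeMagma α, ∀ a ≤ n ^ τ.length,
      treeEval g τ ^ a ∈ wordBall g (C * n) := by
    intro n hn τ a ha
    have := hC n hn (List.replicate a τ) (hon _) (by
      have hn0 : (0 : ℝ) < n := by exact_mod_cast hn
      rw [mass_replicate, div_pow, one_pow, mul_one_div, div_le_one (by positivity)]
      exact_mod_cast ha)
    simpa [wordEval] using this
  set c₀ := U.card * C + 1 with hc₀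
  obtain ⟨M, hM⟩ := exists_cover g hinv hc hC' U hU hUc (4 * c₀ : ℕ)
  have hpos : ∀ r, 0 < (wordBall g r).ncard := fun r =>
    (Set.ncard_pos (wordBall_finite g r)).2 ⟨1, one_mem_wordBall g r⟩
  refine ⟨M + (wordBall g (2 * c₀)).ncard, fun r hr => ?_⟩
  rw [add_mul]
  rcases lt_or_ge r c₀ with hrc | hrc
  · have h1 : (wordBall g (2 * r)).ncard ≤ (wordBall g (2 * c₀)).ncard :=
      Set.ncard_le_ncard (wordBall_mono g (by omega)) (wordBall_finite g _)
    have := Nat.le_mul_of_pos_right (wordBall g (2 * c₀)).ncard (hpos r)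
    omega
  · have hn : 1 ≤ r / c₀ := Nat.div_pos hrc (by omega)
    obtain ⟨X, hXc, hX⟩ := hM (r / c₀) hn
    have hr1 : c₀ * (r / c₀) ≤ r := Nat.mul_div_le _ _
    have hr2 : r < c₀ * (r / c₀ + 1) := Nat.lt_mul_div_succ _ (by omega)
    have hsub : wordBall g (2 * r) ⊆
        Set.image2 (· * ·) (X : Set G) (wordBall g (U.card * C * (r / c₀))) := by
      rintro z ⟨p, hp, rfl⟩
      obtain ⟨x, hx, y, hy, he⟩ := hX (p.map .of) (hon _) (by
        have hn0 : (0 : ℝ) < (r / c₀ : ℕ) := by exact_mod_cast hn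
        rw [mass_map_of, mul_one_div, div_le_iff₀ hn0]
        have : p.length ≤ 4 * c₀ * (r / c₀) := by nlinarith
        exact_mod_cast this)
      rw [wordEval_map_of] at he
      exact ⟨x, hx, y, hy, he.symm⟩
    have hfin := wordBall_finite g (U.card * C * (r / c₀))
    have h1 : (wordBall g (2 * r)).ncard ≤ M * (wordBall g (U.card * C * (r / c₀))).ncard := by
      refine (Set.ncard_le_ncard hsub ((Finset.finite_toSet X).image2 _ hfin)).trans ?_
      rw [← hfin.coe_toFinset, ← Finset.coe_image₂, Set.ncard_coe_finset, Set.ncard_coe_finset]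
      exact (Finset.card_image₂_le _ _ _).trans (by gcongr)
    have h2 : (wordBall g (U.card * C * (r / c₀))).ncard ≤ (wordBall g r).ncard :=
      Set.ncard_le_ncard (wordBall_mono g (by nlinarith)) (wordBall_finite g _)
    nlinarith

open scoped commutatorElement in
lemma treeEval_mem_lowerCentralSeries (g : α → G) (n : ℕ) (τ : FreeMagma α)
    (h : 2 ^ n ≤ τ.length) : treeEval g τ ∈ (⊤ : Subgroup G).lowerCentralSeries n := by
  induction n generalizing τ with
  | zero => simp
  | succ n ih =>
    have key : ∀ x y : G, (x ∈ (⊤ : Subgroup G).lowerCentralSeries n ∨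
        y ∈ (⊤ : Subgroup G).lowerCentralSeries n) →
        ⁅x⁻¹, y⁻¹⁆ ∈ (⊤ : Subgroup G).lowerCentralSeries (n + 1) := by
      intro x y hxy
      rw [Subgroup.lowerCentralSeries_succ]
      rcases hxy with hx | hy
      · exact Subgroup.commutator_mem_commutator (inv_mem hx) (Subgroup.mem_top _)
      · rw [← commutatorElement_inv]
        exact inv_mem (Subgroup.commutator_mem_commutator (inv_mem hy) (Subgroup.mem_top _))
    rcases τ with a | ⟨x, y⟩
    · simp [FreeMagma.length] at h
    · have := key (treeEval g x) (treeEval g y) (by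
        simp only [FreeMagma.length] at h
        rw [pow_succ] at h
        rcases le_or_gt (2 ^ n) x.length with hx | hx
        · exact Or.inl (ih x hx)
        · exact Or.inr (ih y (by omega)))
      rwa [commutatorElement_def, inv_inv, inv_inv] at this

/-- Balls in a finitely generated nilpotent group are doubling. -/
theorem exists_doubling [Finite α] (g : α → G) (hinv : ∀ a, ∃ b, g b = (g a)⁻¹)
    (hG : Group.IsNilpotent G) :
    ∃ M : ℕ, ∀ r : ℕ, 1 ≤ r → (wordBall g (2 * r)).ncard ≤ M * (wordBall g r).ncard := by
  obtain ⟨n, hn⟩ := Subgroup.nilpotent_iff_lowerCentralSeries.1 hG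
  refine exists_doubling_of_treeEval g hinv (c := 2 ^ n) fun τ hτ => ?_
  have := treeEval_mem_lowerCentralSeries g n τ hτ.le
  rwa [hn, Subgroup.mem_bot] at this

end Doubling

section WalkOperator

open scoped InnerProductSpace

variable {E : Type*} [SeminormedAddCommGroup E] [InnerProductSpace ℝ E]
  (U : FreeGroup (Fin d) →* (E →ₗᵢ[ℝ] E))

/-- The inverse of a lazy letter. -/
def letterInv : Letter d → Letter d
  | none => none
  | some (i, b) => some (i, !b)

lemma letterInv_letterInv (a : Letter d) : letterInv (letterInv a) = a := by
  rcases a with _ | ⟨i, b⟩ <;> simp [letterInv]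

lemma letterVal_letterInv (a : Letter d) : letterVal (letterInv a) = (letterVal a)⁻¹ := by
  rcases a with _ | ⟨i, _ | _⟩ <;> simp [letterInv, letterVal]

/-- The averaging operator of the lazy random walk in a representation of the free group. -/
noncomputable def walkOp : E →ₗ[ℝ] E :=
  (Fintype.card (Letter d) : ℝ)⁻¹ • ∑ a : Letter d, (U (letterVal a)).toLinearMap

/-- The total squared displacement of a vector under the letters. -/
noncomputable def energy (f : E) : ℝ := ∑ a : Letter d, ‖f - U (letterVal a) f‖ ^ 2

lemma walkOp_apply (f : E) :
    walkOp U f = (Fintype.card (Letter d) : ℝ)⁻¹ • ∑ a : Letter d, U (letterVal a) f := by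
  simp [walkOp]

lemma card_letter_pos : (0 : ℝ) < Fintype.card (Letter d) := by
  exact_mod_cast Fintype.card_pos

lemma rep_mul_apply (v w : FreeGroup (Fin d)) (f : E) : U (v * w) f = U v (U w f) := by
  rw [map_mul]; rfl

lemma inner_rep_left (w : FreeGroup (Fin d)) (f h : E) : ⟪U w f, h⟫_ℝ = ⟪f, U w⁻¹ h⟫_ℝ := by
  rw [← (U w).inner_map_map f, ← rep_mul_apply]
  simp

lemma walkOp_isSymmetric : (walkOp U).IsSymmetric := by
  intro f h
  simp only [walkOp_apply, real_inner_smul_left, real_inner_smul_right, sum_inner, inner_sum]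
  congr 1
  refine Fintype.sum_equiv (Function.Involutive.toPerm letterInv letterInv_letterInv) _ _
    fun a => ?_
  rw [inner_rep_left, ← letterVal_letterInv]
  rfl

lemma norm_walkOp_le (f : E) : ‖walkOp U f‖ ≤ ‖f‖ := by
  rw [walkOp_apply, norm_smul, norm_inv, Real.norm_natCast, inv_mul_le_iff₀ card_letter_pos]
  refine (norm_sum_le _ _).trans ?_
  simp

lemma norm_walkOp_pow_le (n : ℕ) (f : E) : ‖(walkOp U ^ n) f‖ ≤ ‖f‖ := by
  induction n with
  | zero => simp
  | succ n ih =>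
    rw [pow_succ', Module.End.mul_apply]
    exact (norm_walkOp_le U _).trans ih

lemma inner_walkOp_pow (m n : ℕ) (f h : E) :
    ⟪(walkOp U ^ m) f, (walkOp U ^ n) h⟫_ℝ = ⟪(walkOp U ^ (m + n)) f, h⟫_ℝ := by
  rw [← (walkOp_isSymmetric U).pow n, ← Module.End.mul_apply, ← pow_add, add_comm]

lemma norm_walkOp_pow_sq (n : ℕ) (f : E) :
    ‖(walkOp U ^ n) f‖ ^ 2 = ⟪(walkOp U ^ (2 * n)) f, f⟫_ℝ := by
  rw [← real_inner_self_eq_norm_sq, inner_walkOp_pow, two_mul]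

lemma partialProd_cons {n : ℕ} (a : Letter d) (w : Fin n → Letter d) :
    partialProd (Fin.cons a w : Fin (n + 1) → Letter d) (n + 1) =
      letterVal a * partialProd w n := by
  simp [partialProd, List.ofFn_succ]

lemma walkOp_pow_apply (n : ℕ) (f : E) :
    (walkOp U ^ n) f =
      ((Fintype.card (Letter d) : ℝ) ^ n)⁻¹ • ∑ w : Fin n → Letter d, U (partialProd w n) f := by
  induction n with
  | zero => simp [partialProd]
  | succ n ih =>
    rw [pow_succ', Module.End.mul_apply, ih, walkOp_apply,
      ← (Fin.consEquiv fun _ => Letter d).sum_comp, Fintype.sum_prod_type]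
    simp only [map_smul, map_sum, ← Finset.smul_sum, ← rep_mul_apply]
    rw [smul_smul, pow_succ', mul_inv]
    congr! 5
    exact (partialProd_cons _ _).symm

lemma norm_sub_rep_sq (w : FreeGroup (Fin d)) (f : E) :
    ‖f - U w f‖ ^ 2 = 2 * ‖f‖ ^ 2 - 2 * ⟪U w f, f⟫_ℝ := by
  rw [norm_sub_sq_real, LinearIsometry.norm_map, real_inner_comm]
  ring

lemma energy_nonneg (f : E) : 0 ≤ energy U f := Finset.sum_nonneg fun _ _ => by positivity

lemma energy_eq (f : E) : energy U f =
    2 * Fintype.card (Letter d) * (‖f‖ ^ 2 - ⟪walkOp U f, f⟫_ℝ) := by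
  have := (card_letter_pos (d := d)).ne'
  simp only [energy, norm_sub_rep_sq, Finset.sum_sub_distrib, walkOp_apply, real_inner_smul_left,
    sum_inner, ← Finset.mul_sum]
  simp only [Finset.sum_const, Finset.card_univ, nsmul_eq_mul]
  field_simp

lemma energy_le (f : E) : energy U f ≤
    2 * Fintype.card (Letter d) ^ 2 * (‖f‖ ^ 2 - ‖walkOp U f‖ ^ 2) := by
  have hq := (card_letter_pos (d := d)).ne'
  set S : E := ∑ a : Letter d, U (letterVal a) f with hS
  have h1 : ∑ a : Letter d, ∑ b : Letter d, ‖U (letterVal b) f - U (letterVal a) f‖ ^ 2 =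
      2 * Fintype.card (Letter d) ^ 2 * ‖f‖ ^ 2 - 2 * ‖S‖ ^ 2 := by
    simp only [norm_sub_sq_real, LinearIsometry.norm_map, Finset.sum_add_distrib,
      Finset.sum_sub_distrib, ← Finset.mul_sum, ← sum_inner, ← inner_sum, ← hS]
    simp only [Finset.sum_const, Finset.card_univ, nsmul_eq_mul, real_inner_self_eq_norm_sq]
    ring
  have h2 : energy U f ≤
      ∑ a : Letter d, ∑ b : Letter d, ‖U (letterVal b) f - U (letterVal a) f‖ ^ 2 := by
    refine Finset.sum_le_sum fun a _ => ?_
    have := Finset.single_le_sum (f := fun b : Letter d =>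
      ‖U (letterVal b) f - U (letterVal a) f‖ ^ 2) (fun _ _ => by positivity)
      (Finset.mem_univ (none : Letter d))
    simpa [letterVal] using this
  have h3 : ‖walkOp U f‖ ^ 2 = ((Fintype.card (Letter d) : ℝ) ^ 2)⁻¹ * ‖S‖ ^ 2 := by
    rw [walkOp_apply, norm_smul, mul_pow, norm_inv, Real.norm_natCast, inv_pow]
  rw [h3]
  have h4 : 2 * (Fintype.card (Letter d) : ℝ) ^ 2 *
      (‖f‖ ^ 2 - ((Fintype.card (Letter d) : ℝ) ^ 2)⁻¹ * ‖S‖ ^ 2) =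
      2 * Fintype.card (Letter d) ^ 2 * ‖f‖ ^ 2 - 2 * ‖S‖ ^ 2 := by
    field_simp
  rw [h4, ← h1]
  exact h2

lemma norm_sub_rep_le (f : E) (l : List (Letter d)) :
    ‖f - U (l.map letterVal).prod f‖ ≤ l.length * √(energy U f) := by
  induction l with
  | nil => simp
  | cons a l ih =>
    have h1 : ‖f - U (letterVal a) f‖ ≤ √(energy U f) := Real.le_sqrt_of_sq_le
      (Finset.single_le_sum (f := fun a : Letter d => ‖f - U (letterVal a) f‖ ^ 2)
        (fun _ _ => by positivity) (Finset.mem_univ a))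
    have h2 : f - U ((a :: l).map letterVal).prod f =
        (f - U (letterVal a) f) + U (letterVal a) (f - U (l.map letterVal).prod f) := by
      simp
    rw [h2]
    refine (norm_add_le _ _).trans ?_
    rw [LinearIsometry.norm_map]
    push_cast [List.length_cons]
    linarith

/-- Spectral gap: if a short word acts by `-1` then the walk operator contracts. -/
lemma norm_walkOp_sq_le {l : List (Letter d)} (hl : ∀ f, ‖U (l.map letterVal).prod f + f‖ = 0)
    {m : ℝ} (hm0 : 0 < m) (hm : l.length ≤ m) (f : E) :
    ‖walkOp U f‖ ^ 2 ≤ (1 - 2 / (Fintype.card (Letter d) ^ 2 * m ^ 2)) * ‖f‖ ^ 2 := by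
  have hq := card_letter_pos (d := d)
  have h1 : 2 * ‖f‖ ≤ m * √(energy U f) := by
    calc 2 * ‖f‖ = ‖(U (l.map letterVal).prod f + f) + (f - U (l.map letterVal).prod f)‖ := by
          rw [add_comm _ f, add_assoc, add_sub_cancel, ← two_smul ℝ f, norm_smul]; simp
      _ ≤ 0 + l.length * √(energy U f) :=
          (norm_add_le _ _).trans (add_le_add (hl f).le (norm_sub_rep_le U f l))
      _ ≤ m * √(energy U f) := by rw [zero_add]; gcongr
  have h2 : 4 * ‖f‖ ^ 2 ≤ m ^ 2 * energy U f := by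
    calc 4 * ‖f‖ ^ 2 = (2 * ‖f‖) ^ 2 := by ring
      _ ≤ (m * √(energy U f)) ^ 2 := by gcongr
      _ = m ^ 2 * energy U f := by rw [mul_pow, Real.sq_sqrt (energy_nonneg U f)]
  have h3 := energy_le U f
  have h4 : 2 / (Fintype.card (Letter d) ^ 2 * m ^ 2) * ‖f‖ ^ 2 ≤ ‖f‖ ^ 2 - ‖walkOp U f‖ ^ 2 := by
    rw [div_mul_eq_mul_div, div_le_iff₀ (by positivity)]
    nlinarith [mul_le_mul_of_nonneg_left h3 (sq_nonneg m)]
  linarith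

lemma norm_walkOp_pow_log_convex (k : ℕ) (f : E) :
    ‖(walkOp U ^ (k + 1)) f‖ ^ 2 ≤ ‖(walkOp U ^ k) f‖ * ‖(walkOp U ^ (k + 2)) f‖ := by
  rw [norm_walkOp_pow_sq, show 2 * (k + 1) = k + (k + 2) by ring, ← inner_walkOp_pow]
  exact real_inner_le_norm _ _

lemma pow_mul_norm_le_norm_walkOp_pow {θ : ℝ} (hθ : 0 ≤ θ) {f : E}
    (hf : θ * ‖f‖ ^ 2 ≤ ⟪walkOp U f, f⟫_ℝ) (k : ℕ) : θ ^ k * ‖f‖ ≤ ‖(walkOp U ^ k) f‖ := by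
  have step : ∀ k, θ * ‖(walkOp U ^ k) f‖ ≤ ‖(walkOp U ^ (k + 1)) f‖ := by
    intro k
    induction k with
    | zero =>
      have h := hf.trans (real_inner_le_norm _ _)
      rcases (norm_nonneg f).eq_or_lt with h0 | h0
      · simp [← h0]
      · simp only [pow_zero, Module.End.one_apply, zero_add, pow_one]
        nlinarith
    | succ k ih =>
      have h := norm_walkOp_pow_log_convex U k f
      rcases (norm_nonneg ((walkOp U ^ (k + 1)) f)).eq_or_lt with h0 | h0
      · rw [← h0, mul_zero]; exact norm_nonneg _
      · refine le_of_mul_le_mul_right ?_ h0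
        have := mul_le_mul_of_nonneg_right ih (norm_nonneg ((walkOp U ^ (k + 2)) f))
        nlinarith [mul_le_mul_of_nonneg_left h hθ]
  induction k with
  | zero => simp
  | succ k ih =>
    calc θ ^ (k + 1) * ‖f‖ = θ * (θ ^ k * ‖f‖) := by ring
      _ ≤ θ * ‖(walkOp U ^ k) f‖ := by gcongr
      _ ≤ _ := step k

lemma norm_walkOp_pow_sq_le {γ : ℝ} (hγ : 0 ≤ γ)
    (h : ∀ f, ‖walkOp U f‖ ^ 2 ≤ γ * ‖f‖ ^ 2) (k : ℕ) (f : E) :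
    ‖(walkOp U ^ k) f‖ ^ 2 ≤ γ ^ k * ‖f‖ ^ 2 := by
  induction k with
  | zero => simp
  | succ k ih =>
    rw [pow_succ' (walkOp U), Module.End.mul_apply]
    refine (h _).trans ?_
    rw [pow_succ' γ, mul_assoc]
    gcongr

end WalkOperator

section PullSpace

open scoped InnerProductSpace

/-- Finitely supported functions on `X`, with the inner product pulled back from `H` along the
linear extension of `v : X → H`. -/
def PullSpace {X H : Type*} (_ : X → H) : Type _ := X →₀ ℝ

variable {X H : Type*} [NormedAddCommGroup H] [InnerProductSpace ℝ H] (v : X → H)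

noncomputable instance : AddCommGroup (PullSpace v) := inferInstanceAs (AddCommGroup (X →₀ ℝ))

noncomputable instance : Module ℝ (PullSpace v) := inferInstanceAs (Module ℝ (X →₀ ℝ))

/-- The linear map inducing the inner product. -/
noncomputable def pullMap : PullSpace v →ₗ[ℝ] H := Finsupp.linearCombination ℝ v

noncomputable instance : SeminormedAddCommGroup (PullSpace v) :=
  SeminormedAddCommGroup.induced (PullSpace v) H (pullMap v)

noncomputable instance : InnerProductSpace ℝ (PullSpace v) where
  norm_smul_le a f := by
    change ‖pullMap v (a • f)‖ ≤ ‖a‖ * ‖pullMap v f‖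
    rw [map_smul, norm_smul]
  inner f h := ⟪pullMap v f, pullMap v h⟫_ℝ
  norm_sq_eq_re_inner f := norm_sq_eq_re_inner (𝕜 := ℝ) (pullMap v f)
  conj_inner_symm f h := inner_conj_symm (𝕜 := ℝ) (pullMap v f) (pullMap v h)
  add_left f g h := by simp [inner_add_left]
  smul_left f g a := by simp [inner_smul_left]

lemma PullSpace.inner_def (f h : PullSpace v) : ⟪f, h⟫_ℝ = ⟪pullMap v f, pullMap v h⟫_ℝ := rfl

lemma PullSpace.norm_def (f : PullSpace v) : ‖f‖ = ‖pullMap v f‖ := rfl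

/-- The point mass at `x`. -/
noncomputable def pointMass (x : X) : PullSpace v := Finsupp.single x (1 : ℝ)

@[simp] lemma pullMap_pointMass (x : X) : pullMap v (pointMass v x) = v x :=
  (Finsupp.linearCombination_single ℝ 1 x).trans (one_smul ℝ _)

lemma inner_linearCombination_congr {v v' : X → H} (h : ∀ x y, ⟪v x, v y⟫_ℝ = ⟪v' x, v' y⟫_ℝ)
    (f f' : X →₀ ℝ) : ⟪Finsupp.linearCombination ℝ v f, Finsupp.linearCombination ℝ v f'⟫_ℝ =
      ⟪Finsupp.linearCombination ℝ v' f, Finsupp.linearCombination ℝ v' f'⟫_ℝ := by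
  simp only [Finsupp.linearCombination_apply, Finsupp.sum, sum_inner, inner_sum,
    real_inner_smul_left, real_inner_smul_right, h]

variable {Γ : Type*} [Group Γ] [MulAction Γ X]

/-- An action preserving the Gram matrix of `v` acts isometrically. -/
noncomputable def pullRep (hv : ∀ (w : Γ) x y, ⟪v (w • x), v (w • y)⟫_ℝ = ⟪v x, v y⟫_ℝ) :
    Γ →* (PullSpace v →ₗᵢ[ℝ] PullSpace v) where
  toFun w :=
    { toLinearMap := (Finsupp.lmapDomain ℝ ℝ (w • · : X → X) : (X →₀ ℝ) →ₗ[ℝ] (X →₀ ℝ))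
      norm_map' := fun f => by
        have h : pullMap v (Finsupp.lmapDomain ℝ ℝ (w • · : X → X) f : X →₀ ℝ) =
            Finsupp.linearCombination ℝ (fun x => v (w • x)) f :=
          Finsupp.linearCombination_mapDomain ℝ _ _
        have h2 := inner_linearCombination_congr (hv w) f f
        rw [real_inner_self_eq_norm_sq, real_inner_self_eq_norm_sq] at h2
        rw [PullSpace.norm_def, PullSpace.norm_def]
        refine Eq.trans (congrArg norm h) ?_
        exact (sq_eq_sq₀ (norm_nonneg _) (norm_nonneg _)).1 h2 }
  map_one' := by
    ext f : 1
    refine (Finsupp.mapDomain_congr fun x _ => one_smul Γ x).trans Finsupp.mapDomain_id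
  map_mul' w w' := by
    ext f : 1
    refine (Finsupp.mapDomain_congr fun x _ => mul_smul w w' x).trans ?_
    exact Finsupp.mapDomain_comp (f := (w' • · : X → X)) (g := (w • · : X → X))

variable {v} (hv : ∀ (w : Γ) x y, ⟪v (w • x), v (w • y)⟫_ℝ = ⟪v x, v y⟫_ℝ)

lemma pullRep_apply (w : Γ) (f : PullSpace v) (x : X) :
    (show X →₀ ℝ from pullRep v hv w f) x = (show X →₀ ℝ from f) (w⁻¹ • x) := by
  conv_lhs => rw [← smul_inv_smul w x]
  exact Finsupp.mapDomain_apply (MulAction.injective w) _ _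

@[simp] lemma pullRep_pointMass (w : Γ) (x : X) :
    pullRep v hv w (pointMass v x) = pointMass v (w • x) :=
  Finsupp.mapDomain_single

lemma PullSpace.norm_eq_zero_of_inner {f : PullSpace v} (h : ∀ x, ⟪f, pointMass v x⟫_ℝ = 0) :
    ‖f‖ = 0 := by
  have h2 : ∀ g : X →₀ ℝ, ⟪pullMap v f, Finsupp.linearCombination ℝ v g⟫_ℝ = 0 := by
    intro g
    simp only [Finsupp.linearCombination_apply, Finsupp.sum, inner_sum, real_inner_smul_right]
    refine Finset.sum_eq_zero fun x _ => ?_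
    have := h x
    rw [PullSpace.inner_def, pullMap_pointMass] at this
    rw [this, mul_zero]
  have := h2 f
  rw [PullSpace.norm_def, ← sq_eq_zero_iff, ← real_inner_self_eq_norm_sq]
  exact this

lemma PullSpace.norm_sq_of_orthonormal (hv : Orthonormal ℝ v) (f : X →₀ ℝ) :
    ‖(show PullSpace v from f)‖ ^ 2 = ∑ x ∈ f.support, f x ^ 2 := by
  rw [← real_inner_self_eq_norm_sq]
  refine (hv.inner_finsupp_eq_sum_left f f).trans ?_
  simp [Finsupp.sum, sq]

end PullSpace

section Representations

open scoped InnerProductSpace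

/-- The standard orthonormal family of `ℓ²(ι)`. -/
noncomputable def basisVec (ι : Type*) (i : ι) : lp (fun _ : ι => ℝ) 2 :=
  (default : HilbertBasis ι ℝ (lp (fun _ : ι => ℝ) 2)) i

lemma orthonormal_basisVec (ι : Type*) : Orthonormal ℝ (basisVec ι) :=
  (default : HilbertBasis ι ℝ (lp (fun _ : ι => ℝ) 2)).orthonormal

variable (R : Subgroup (FreeGroup (Fin d)))

/-- The regular representation on the finitely supported functions on the quotient by `R`. -/
noncomputable def regRep : FreeGroup (Fin d) →* (PullSpace (basisVec (FreeGroup (Fin d) ⧸ R)) →ₗᵢ[ℝ]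
    PullSpace (basisVec (FreeGroup (Fin d) ⧸ R))) :=
  pullRep _ fun w x y => by
    classical
    simp [orthonormal_iff_ite.1 (orthonormal_basisVec _)]

open scoped Classical in
/-- The probability that the lazy word of length `n` lies in `R`. -/
noncomputable def returnProb (n : ℕ) : ℝ :=
  ((Fintype.card (Letter d) : ℝ) ^ n)⁻¹ *
    ∑ w : Fin n → Letter d, if partialProd w n ∈ R then 1 else 0

lemma inner_walkOp_pow_pointMass [R.Normal] (n : ℕ) (x : FreeGroup (Fin d) ⧸ R) :
    ⟪(walkOp (regRep R) ^ n) (pointMass _ x), pointMass _ x⟫_ℝ = returnProb R n := by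
  classical
  rw [walkOp_pow_apply, returnProb, real_inner_smul_left, sum_inner]
  congr 1
  refine Finset.sum_congr rfl fun w _ => ?_
  rw [regRep, pullRep_pointMass, PullSpace.inner_def, pullMap_pointMass, pullMap_pointMass,
    orthonormal_iff_ite.1 (orthonormal_basisVec _)]
  congr 1
  induction x using QuotientGroup.induction_on with
  | H z =>
  rw [MulAction.Quotient.smul_mk, eq_comm, QuotientGroup.eq, eq_iff_iff, smul_eq_mul]
  constructor
  · intro h
    simpa [mul_assoc] using (inferInstance : R.Normal).conj_mem _ (R.inv_mem h) z⁻¹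
  · intro h
    simpa [mul_assoc] using (inferInstance : R.Normal).conj_mem _ (R.inv_mem h) z

lemma returnProb_nonneg (n : ℕ) : 0 ≤ returnProb R n := by
  classical
  unfold returnProb
  positivity

lemma norm_pointMass_basisVec (x : FreeGroup (Fin d) ⧸ R) :
    ‖pointMass (basisVec (FreeGroup (Fin d) ⧸ R)) x‖ = 1 := by
  rw [PullSpace.norm_def, pullMap_pointMass]
  exact (orthonormal_basisVec _).1 x

section Twisted

variable (φ : FreeGroup (Fin d) → ℝ)

/-- The angle of `x` relative to the chosen representative of its coset. -/
noncomputable def cosetAngle (x : FreeGroup (Fin d)) : ℝ :=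
  φ ((Quotient.out (x : FreeGroup (Fin d) ⧸ R))⁻¹ * x)

/-- The vectors generating the representation induced from the character `exp (i φ)` of `R`. -/
noncomputable def twistedVec (x : FreeGroup (Fin d)) :
    lp (fun _ : (FreeGroup (Fin d) ⧸ R) × Bool => ℝ) 2 :=
  Real.cos (cosetAngle R φ x) • basisVec _ ((x : FreeGroup (Fin d) ⧸ R), true) +
    Real.sin (cosetAngle R φ x) • basisVec _ ((x : FreeGroup (Fin d) ⧸ R), false)

variable {R φ} (hφ : ∀ x ∈ R, ∀ y ∈ R, φ (x * y) = φ x + φ y)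
include hφ

open scoped Classical in
lemma inner_twistedVec (x y : FreeGroup (Fin d)) :
    ⟪twistedVec R φ x, twistedVec R φ y⟫_ℝ =
      if x⁻¹ * y ∈ R then Real.cos (φ (x⁻¹ * y)) else 0 := by
  simp only [twistedVec, inner_add_left, inner_add_right, real_inner_smul_left,
    real_inner_smul_right, orthonormal_iff_ite.1 (orthonormal_basisVec _), Prod.mk.injEq]
  by_cases h : (x : FreeGroup (Fin d) ⧸ R) = y
  · have h2 := h
    rw [QuotientGroup.eq] at h2
    have h3 : cosetAngle R φ y = cosetAngle R φ x + φ (x⁻¹ * y) := by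
      rw [cosetAngle, cosetAngle, ← h, ← hφ _ _ _ h2]
      · congr 1; group
      · rw [← QuotientGroup.eq]; simp
    rw [if_pos h2, show φ (x⁻¹ * y) = cosetAngle R φ y - cosetAngle R φ x by rw [h3]; ring,
      Real.cos_sub]
    simp [h]
  · rw [if_neg (c := x⁻¹ * y ∈ R) (by rwa [← QuotientGroup.eq])]
    simp [h]

/-- The representation induced from the character `exp (i φ)` of `R`. -/
noncomputable def twistedRep :
    FreeGroup (Fin d) →* (PullSpace (twistedVec R φ) →ₗᵢ[ℝ] PullSpace (twistedVec R φ)) :=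
  pullRep _ fun w x y => by
    have h : (w * x)⁻¹ * (w * y) = x⁻¹ * y := by group
    rw [inner_twistedVec hφ, inner_twistedVec hφ, smul_eq_mul, smul_eq_mul, h]

lemma map_one_of_add : φ 1 = 0 := by
  simpa using hφ 1 R.one_mem 1 R.one_mem

lemma map_inv_of_add {x : FreeGroup (Fin d)} (hx : x ∈ R) : φ x⁻¹ = -φ x := by
  have := hφ x hx x⁻¹ (R.inv_mem hx)
  rw [mul_inv_cancel, map_one_of_add hφ] at this
  linarith

lemma norm_pointMass_twisted (x : FreeGroup (Fin d)) : ‖pointMass (twistedVec R φ) x‖ = 1 := by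
  have : ‖pointMass (twistedVec R φ) x‖ ^ 2 = 1 := by
    rw [← real_inner_self_eq_norm_sq, PullSpace.inner_def, pullMap_pointMass, inner_twistedVec hφ]
    simp [R.one_mem, map_one_of_add hφ]
  exact (pow_eq_one_iff_of_nonneg (norm_nonneg _) two_ne_zero).1 this

open scoped Classical in
lemma inner_twistedRep_pointMass (w : FreeGroup (Fin d)) :
    ⟪twistedRep hφ w (pointMass _ 1), pointMass _ 1⟫_ℝ =
      if w ∈ R then Real.cos (φ w) else 0 := by
  rw [twistedRep, pullRep_pointMass, PullSpace.inner_def, pullMap_pointMass, pullMap_pointMass,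
    inner_twistedVec hφ]
  simp only [smul_eq_mul, mul_one, R.inv_mem_iff]
  refine if_ctx_congr Iff.rfl (fun h => ?_) fun _ => rfl
  rw [map_inv_of_add hφ h, Real.cos_neg]

lemma norm_twistedRep_add_eq_zero [R.Normal] (hconj : ∀ x ∈ R, ∀ y, φ (y⁻¹ * x * y) = φ x)
    {z : FreeGroup (Fin d)} (hz : z ∈ R) (hzφ : φ z = Real.pi)
    (f : PullSpace (twistedVec R φ)) : ‖twistedRep hφ z f + f‖ = 0 := by
  have h1 : ∀ x, ‖twistedRep hφ z (pointMass _ x) + pointMass _ x‖ = 0 := by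
    intro x
    have hx : x⁻¹ * z⁻¹ * x ∈ R := by
      simpa using (inferInstance : R.Normal).conj_mem _ (R.inv_mem hz) x⁻¹
    have h2 : ‖twistedRep hφ z (pointMass _ x) + pointMass _ x‖ ^ 2 = 0 := by
      rw [norm_add_sq_real, LinearIsometry.norm_map, norm_pointMass_twisted hφ, twistedRep,
        pullRep_pointMass, PullSpace.inner_def, pullMap_pointMass, pullMap_pointMass,
        inner_twistedVec hφ, smul_eq_mul, mul_inv_rev, if_pos hx, hconj _ (R.inv_mem hz),
        map_inv_of_add hφ hz, hzφ]
      norm_num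
    exact pow_eq_zero_iff two_ne_zero |>.1 h2
  refine PullSpace.norm_eq_zero_of_inner fun x => ?_
  have h3 : ⟪twistedRep hφ z f + f, pointMass _ x⟫_ℝ =
      ⟪twistedRep hφ z f, twistedRep hφ z (pointMass _ x) + pointMass _ x⟫_ℝ := by
    rw [inner_add_left, inner_add_right, LinearIsometry.inner_map_map, add_comm]
  rw [h3, ← abs_eq_zero]
  refine le_antisymm ((abs_real_inner_le_norm _ _).trans ?_) (abs_nonneg _)
  rw [h1, mul_zero]

end Twisted
end Representations

section HeatKernel

open scoped InnerProductSpace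

variable (R : Subgroup (FreeGroup (Fin d))) [R.Normal]

/-- The image of a lazy letter in the quotient by `R`. -/
def quotLetter (a : Letter d) : FreeGroup (Fin d) ⧸ R := (letterVal a : FreeGroup (Fin d))

lemma prod_map_quotLetter (l : List (Letter d)) :
    (l.map (quotLetter R)).prod = ((l.map letterVal).prod : FreeGroup (Fin d)) := by
  change _ = QuotientGroup.mk' R _
  rw [map_list_prod, List.map_map]
  rfl

lemma exists_quotLetter_eq_inv (a : Letter d) : ∃ b, quotLetter R b = (quotLetter R a)⁻¹ :=
  ⟨letterInv a, by rw [quotLetter, letterVal_letterInv]; rfl⟩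

/-- The number of elements of the ball of radius `n` in the quotient by `R`. -/
noncomputable def growth (n : ℕ) : ℕ := (wordBall (quotLetter R) n).ncard

lemma growth_pos (n : ℕ) : 0 < growth R n :=
  (Set.ncard_pos (wordBall_finite _ n)).2 ⟨1, one_mem_wordBall _ n⟩

lemma growth_mono {m n : ℕ} (h : m ≤ n) : growth R m ≤ growth R n :=
  Set.ncard_le_ncard (wordBall_mono _ h) (wordBall_finite _ n)

lemma smul_eq_coe_mul (w : FreeGroup (Fin d)) (x : FreeGroup (Fin d) ⧸ R) :
    w • x = (w : FreeGroup (Fin d) ⧸ R) * x := by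
  induction x using QuotientGroup.induction_on with
  | H z => rfl

lemma returnProb_two_mul (j : ℕ) (x : FreeGroup (Fin d) ⧸ R) :
    returnProb R (2 * j) = ‖(walkOp (regRep R) ^ j) (pointMass _ x)‖ ^ 2 := by
  rw [norm_walkOp_pow_sq, inner_walkOp_pow_pointMass]

lemma norm_sum_pointMass_mul_sq (B : Finset (FreeGroup (Fin d) ⧸ R)) (y : FreeGroup (Fin d) ⧸ R) :
    ‖∑ x ∈ B, pointMass (basisVec (FreeGroup (Fin d) ⧸ R)) (x * y)‖ ^ 2 = B.card := by
  classical
  rw [PullSpace.norm_def, map_sum, ← real_inner_self_eq_norm_sq]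
  simp only [pullMap_pointMass, sum_inner, inner_sum,
    orthonormal_iff_ite.1 (orthonormal_basisVec _), mul_left_inj]
  simp

/-- A Nash-type inequality for the distribution of the random walk. -/
lemma norm_walkOp_pow_pointMass_le (j n : ℕ) :
    ‖(walkOp (regRep R) ^ j) (pointMass _ 1)‖ ≤
      n * √(energy (regRep R) ((walkOp (regRep R) ^ j) (pointMass _ 1))) +
        (√(growth R n))⁻¹ := by
  classical
  set f := (walkOp (regRep R) ^ j) (pointMass _ 1) with hf
  have hfin := wordBall_finite (quotLetter R) n
  have hB : ∀ x : FreeGroup (Fin d) ⧸ R, ∃ l : List (Letter d), x ∈ hfin.toFinset →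
      l.length ≤ n ∧ ((l.map letterVal).prod : FreeGroup (Fin d) ⧸ R) = x := by
    intro x
    by_cases hx : x ∈ hfin.toFinset
    · obtain ⟨l, hl, he⟩ := hfin.mem_toFinset.1 hx
      exact ⟨l, fun _ => ⟨hl, by rw [← he, prod_map_quotLetter]⟩⟩
    · exact ⟨[], fun h => absurd h hx⟩
  choose l hl using hB
  have hcard : hfin.toFinset.card = growth R n := (Set.ncard_eq_toFinset_card _ hfin).symm
  have hV : (0 : ℝ) < growth R n := by exact_mod_cast growth_pos R n
  set A : PullSpace (basisVec (FreeGroup (Fin d) ⧸ R)) →ₗ[ℝ] _ :=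
    (growth R n : ℝ)⁻¹ • ∑ x ∈ hfin.toFinset, (regRep R ((l x).map letterVal).prod).toLinearMap
    with hA
  have hAapp : ∀ f, A f = (growth R n : ℝ)⁻¹ •
      ∑ x ∈ hfin.toFinset, regRep R ((l x).map letterVal).prod f := fun f => by
    simp [hA]
  have h1 : ‖f - A f‖ ≤ n * √(energy (regRep R) f) := by
    have : f - A f = (growth R n : ℝ)⁻¹ •
        ∑ x ∈ hfin.toFinset, (f - regRep R ((l x).map letterVal).prod f) := by
      rw [hAapp, Finset.sum_sub_distrib, smul_sub, Finset.sum_const, hcard,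
        ← Nat.cast_smul_eq_nsmul ℝ, smul_smul, inv_mul_cancel₀ hV.ne', one_smul]
    rw [this, norm_smul, norm_inv, Real.norm_natCast, inv_mul_le_iff₀ hV]
    refine (norm_sum_le _ _).trans ?_
    refine (Finset.sum_le_card_nsmul _ _ (n * √(energy (regRep R) f)) fun x hx => ?_).trans ?_
    · refine (norm_sub_rep_le _ _ _).trans ?_
      have := (hl x hx).1
      gcongr
    · rw [hcard, nsmul_eq_mul]
  have h2 : ∀ x, ‖A (pointMass _ x)‖ = (√(growth R n))⁻¹ := by
    intro x
    have h3 : ∑ y ∈ hfin.toFinset, regRep R ((l y).map letterVal).prod (pointMass _ x) =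
        ∑ y ∈ hfin.toFinset, pointMass (basisVec (FreeGroup (Fin d) ⧸ R)) (y * x) := by
      refine Finset.sum_congr rfl fun y hy => ?_
      rw [regRep, pullRep_pointMass, smul_eq_coe_mul, (hl y hy).2]
    have h4 := norm_sum_pointMass_mul_sq R hfin.toFinset x
    rw [hcard] at h4
    rw [hAapp, h3, norm_smul, norm_inv, Real.norm_natCast, ← Real.sqrt_sq (norm_nonneg _), h4]
    rw [inv_mul_eq_div, Real.sqrt_div_self']
    simp
  have h3 : ‖A f‖ ≤ (√(growth R n))⁻¹ := by
    have hq : (0 : ℝ) < (Fintype.card (Letter d) : ℝ) ^ j := pow_pos card_letter_pos j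
    rw [hf, walkOp_pow_apply, map_smul, map_sum, norm_smul, norm_inv, Real.norm_of_nonneg hq.le,
      inv_mul_le_iff₀ hq]
    refine (norm_sum_le _ _).trans ?_
    refine (Finset.sum_le_card_nsmul _ _ ((√(growth R n))⁻¹) fun w _ => ?_).trans ?_
    · rw [regRep, pullRep_pointMass, h2]
    · simp
  calc ‖f‖ = ‖(f - A f) + A f‖ := by rw [sub_add_cancel]
    _ ≤ _ := (norm_add_le _ _).trans (add_le_add h1 h3)

lemma returnProb_nash (j n : ℕ) : returnProb R (2 * j) ≤
    4 * n ^ 2 * Fintype.card (Letter d) ^ 2 *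
      (returnProb R (2 * j) - returnProb R (2 * (j + 1))) + 2 / growth R n := by
  have h1 := norm_walkOp_pow_pointMass_le R j n
  have h2 := energy_le (regRep R) ((walkOp (regRep R) ^ j) (pointMass _ 1))
  rw [← Module.End.mul_apply, ← pow_succ'] at h2
  rw [returnProb_two_mul R _ 1, returnProb_two_mul R _ 1]
  set a := ‖(walkOp (regRep R) ^ j) (pointMass _ 1)‖
  set D := energy (regRep R) ((walkOp (regRep R) ^ j) (pointMass _ 1))
  have hD : 0 ≤ D := energy_nonneg _ _
  have h3 : a ^ 2 ≤ (n * √D + (√(growth R n))⁻¹) ^ 2 := by gcongr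
  have h4 : (n * √D + (√(growth R n))⁻¹) ^ 2 ≤ 2 * (n * √D) ^ 2 + 2 * ((√(growth R n))⁻¹) ^ 2 := by
    nlinarith [sq_nonneg (n * √D - (√(growth R n))⁻¹)]
  rw [mul_pow, Real.sq_sqrt hD, inv_pow, Real.sq_sqrt (Nat.cast_nonneg _)] at h4
  have h5 := mul_le_mul_of_nonneg_left h2 (sq_nonneg (n : ℝ))
  rw [div_eq_mul_inv]
  linarith

lemma returnProb_zero : returnProb R 0 = 1 := by
  have := returnProb_two_mul R 0 1
  simpa [norm_pointMass_basisVec] using this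

lemma returnProb_two_mul_anti {i j : ℕ} (h : i ≤ j) :
    returnProb R (2 * j) ≤ returnProb R (2 * i) := by
  rw [returnProb_two_mul R _ 1, returnProb_two_mul R _ 1, ← Nat.sub_add_cancel h, pow_add,
    Module.End.mul_apply]
  gcongr
  exact norm_walkOp_pow_le _ _ _

lemma norm_walkOp_pow_sq_le_card_mul (j : ℕ) (f : (FreeGroup (Fin d) ⧸ R) →₀ ℝ) :
    ‖(walkOp (regRep R) ^ j) (show PullSpace (basisVec (FreeGroup (Fin d) ⧸ R)) from f)‖ ^ 2 ≤
      f.support.card * (∑ x ∈ f.support, f x ^ 2) * returnProb R (2 * j) := by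
  have h0 : (show PullSpace (basisVec (FreeGroup (Fin d) ⧸ R)) from f) =
      ∑ x ∈ f.support, f x • pointMass (basisVec (FreeGroup (Fin d) ⧸ R)) x := by
    refine (Finsupp.sum_single f).symm.trans (Finset.sum_congr rfl fun x _ => ?_)
    exact (Finsupp.smul_single_one x (f x)).symm
  have h1 : ‖(walkOp (regRep R) ^ j)
      (∑ x ∈ f.support, f x • pointMass (basisVec (FreeGroup (Fin d) ⧸ R)) x)‖ ≤
        (∑ x ∈ f.support, |f x|) * √(returnProb R (2 * j)) := by
    rw [map_sum, Finset.sum_mul]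
    refine (norm_sum_le _ _).trans (Finset.sum_le_sum fun x _ => ?_)
    rw [map_smul, norm_smul, Real.norm_eq_abs, returnProb_two_mul R j x,
      Real.sqrt_sq (norm_nonneg _)]
  rw [← h0] at h1
  have h2 : (∑ x ∈ f.support, |f x|) ^ 2 ≤ f.support.card * ∑ x ∈ f.support, f x ^ 2 := by
    simpa using sq_sum_le_card_mul_sum_sq (s := f.support) (f := fun x => |f x|)
  calc _ ≤ ((∑ x ∈ f.support, |f x|) * √(returnProb R (2 * j))) ^ 2 := by gcongr
    _ = (∑ x ∈ f.support, |f x|) ^ 2 * returnProb R (2 * j) := by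
      rw [mul_pow, Real.sq_sqrt (returnProb_nonneg R _)]
    _ ≤ _ := by gcongr; exact returnProb_nonneg R _

end HeatKernel

lemma prod_map_letterVal_some (L : List (Fin d × Bool)) :
    ((L.map some).map letterVal).prod = FreeGroup.mk L := by
  induction L with
  | nil => rfl
  | cons a L ih =>
    have h : FreeGroup.mk (a :: L) = FreeGroup.mk [a] * FreeGroup.mk L := by
      rw [FreeGroup.mul_mk]; rfl
    rw [List.map_cons, List.map_cons, List.prod_cons, ih, h]
    congr 1
    rcases a with ⟨i, _ | _⟩ <;> simp [letterVal, FreeGroup.of, FreeGroup.inv_mk, FreeGroup.invRev]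

lemma exists_letters_eq (w : FreeGroup (Fin d)) :
    ∃ l : List (Letter d), l.length = w.norm ∧ (l.map letterVal).prod = w :=
  ⟨w.toWord.map some, by simp [FreeGroup.norm], by
    rw [prod_map_letterVal_some, FreeGroup.mk_toWord]⟩

section Tent

open scoped InnerProductSpace

variable (R : Subgroup (FreeGroup (Fin d))) [R.Normal]

/-- The word length of an element of the quotient by `R`. -/
noncomputable def quotLength (x : FreeGroup (Fin d) ⧸ R) : ℕ :=
  sInf {n | x ∈ wordBall (quotLetter R) n}

lemma mem_wordBall_quotLength (x : FreeGroup (Fin d) ⧸ R) :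
    x ∈ wordBall (quotLetter R) (quotLength R x) := by
  refine Nat.sInf_mem (s := {n | x ∈ wordBall (quotLetter R) n}) ?_
  induction x using QuotientGroup.induction_on with
  | H z =>
  obtain ⟨l, -, hl⟩ := exists_letters_eq z
  exact ⟨l.length, l, le_rfl, by rw [prod_map_quotLetter, hl]⟩

lemma mem_wordBall_iff_quotLength_le {x : FreeGroup (Fin d) ⧸ R} {n : ℕ} :
    x ∈ wordBall (quotLetter R) n ↔ quotLength R x ≤ n :=
  ⟨fun h => Nat.sInf_le h, fun h => wordBall_mono _ h (mem_wordBall_quotLength R x)⟩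

lemma quotLength_letter_mul_le (a : Letter d) (x : FreeGroup (Fin d) ⧸ R) :
    quotLength R (quotLetter R a * x) ≤ quotLength R x + 1 := by
  rw [← mem_wordBall_iff_quotLength_le, add_comm]
  exact mul_mem_wordBall ⟨[a], by simp, by simp⟩ (mem_wordBall_quotLength R x)

lemma quotLength_le_letter_mul (a : Letter d) (x : FreeGroup (Fin d) ⧸ R) :
    quotLength R x ≤ quotLength R (quotLetter R a * x) + 1 := by
  obtain ⟨b, hb⟩ := exists_quotLetter_eq_inv R a
  simpa [hb] using quotLength_letter_mul_le R b (quotLetter R a * x)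

/-- The tent function of radius `n` on the quotient by `R`. -/
noncomputable def tent (n : ℕ) : (FreeGroup (Fin d) ⧸ R) →₀ ℝ :=
  Finsupp.onFinset (wordBall_finite (quotLetter R) n).toFinset
    (fun x => ((n - quotLength R x : ℕ) : ℝ)) fun x hx => by
      rw [Set.Finite.mem_toFinset, mem_wordBall_iff_quotLength_le]
      have : n - quotLength R x ≠ 0 := by exact_mod_cast hx
      omega

lemma tent_apply (n : ℕ) (x : FreeGroup (Fin d) ⧸ R) :
    tent R n x = ((n - quotLength R x : ℕ) : ℝ) := rfl

lemma card_finset_le_growth {n : ℕ} {B : Finset (FreeGroup (Fin d) ⧸ R)}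
    (h : ∀ x ∈ B, quotLength R x ≤ n) : B.card ≤ growth R n := by
  rw [← Set.ncard_coe_finset]
  exact Set.ncard_le_ncard (fun x hx => (mem_wordBall_iff_quotLength_le R).2 (h x hx))
    (wordBall_finite _ n)

lemma card_support_tent_le (n : ℕ) : (tent R n).support.card ≤ growth R n := by
  refine card_finset_le_growth R fun x hx => ?_
  rw [Finsupp.mem_support_iff, tent_apply, Nat.cast_ne_zero] at hx
  omega

lemma le_sum_tent_sq (n : ℕ) :
    (n : ℝ) ^ 2 * growth R n ≤ ∑ x ∈ (tent R (2 * n)).support, tent R (2 * n) x ^ 2 := by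
  classical
  have hfin := wordBall_finite (quotLetter R) n
  have h1 : ∀ x ∈ hfin.toFinset, (n : ℝ) ≤ tent R (2 * n) x := by
    intro x hx
    rw [Set.Finite.mem_toFinset, mem_wordBall_iff_quotLength_le] at hx
    rw [tent_apply]
    exact_mod_cast (by omega : n ≤ 2 * n - quotLength R x)
  calc (n : ℝ) ^ 2 * growth R n = ∑ x ∈ hfin.toFinset, (n : ℝ) ^ 2 := by
        rw [Finset.sum_const, growth, Set.ncard_eq_toFinset_card _ hfin, nsmul_eq_mul, mul_comm]
    _ ≤ ∑ x ∈ hfin.toFinset, tent R (2 * n) x ^ 2 :=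
        Finset.sum_le_sum fun x hx => by have := h1 x hx; gcongr
    _ ≤ ∑ x ∈ hfin.toFinset ∪ (tent R (2 * n)).support, tent R (2 * n) x ^ 2 :=
        Finset.sum_le_sum_of_subset_of_nonneg Finset.subset_union_left fun _ _ _ => by positivity
    _ = _ := by
        refine (Finset.sum_subset Finset.subset_union_right fun x _ hx => ?_).symm
        rw [Finsupp.notMem_support_iff.1 hx]; simp

lemma energy_tent_le (n : ℕ) :
    energy (regRep R) (show PullSpace (basisVec (FreeGroup (Fin d) ⧸ R)) from tent R n) ≤
      Fintype.card (Letter d) * growth R (n + 1) := by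
  refine (Finset.sum_le_card_nsmul _ _ (growth R (n + 1) : ℝ) fun a _ => ?_).trans_eq
    (by rw [Finset.card_univ, nsmul_eq_mul])
  set g : (FreeGroup (Fin d) ⧸ R) →₀ ℝ := tent R n -
    (show (FreeGroup (Fin d) ⧸ R) →₀ ℝ from regRep R (letterVal a) (tent R n)) with hg
  have hgx : ∀ x, g x = ((n - quotLength R x : ℕ) : ℝ) -
      ((n - quotLength R (quotLetter R (letterInv a) * x) : ℕ) : ℝ) := by
    intro x
    refine (Finsupp.sub_apply _ _ _).trans (congrArg (tent R n x - ·) ?_)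
    refine (pullRep_apply _ (letterVal a) (tent R n) x).trans ?_
    rw [smul_eq_coe_mul, ← letterVal_letterInv]
    rfl
  refine (PullSpace.norm_sq_of_orthonormal (orthonormal_basisVec _) g).trans_le ?_
  have hl1 := fun x => quotLength_letter_mul_le R (letterInv a) x
  have hl2 := fun x => quotLength_le_letter_mul R (letterInv a) x
  refine (Finset.sum_le_card_nsmul _ _ 1 fun x _ => ?_).trans ?_
  · rw [hgx, sq_le_one_iff_abs_le_one, abs_le]
    have h1 := hl1 x
    have h2 := hl2 x
    constructor
    · have : n - quotLength R (quotLetter R (letterInv a) * x) ≤ n - quotLength R x + 1 := by omega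
      have : ((n - quotLength R (quotLetter R (letterInv a) * x) : ℕ) : ℝ) ≤
        ((n - quotLength R x : ℕ) : ℝ) + 1 := by exact_mod_cast this
      linarith
    · have : n - quotLength R x ≤ n - quotLength R (quotLetter R (letterInv a) * x) + 1 := by omega
      have : ((n - quotLength R x : ℕ) : ℝ) ≤
        ((n - quotLength R (quotLetter R (letterInv a) * x) : ℕ) : ℝ) + 1 := by exact_mod_cast this
      linarith
  · rw [nsmul_eq_mul, mul_one]
    refine Nat.cast_le.2 (card_finset_le_growth R fun x hx => ?_)
    rw [Finsupp.mem_support_iff, hgx] at hx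
    by_contra h
    refine hx ?_
    have h2 := hl2 x
    rw [Nat.sub_eq_zero_of_le (by omega), Nat.sub_eq_zero_of_le (by omega), sub_self]

/-- A lower bound for the return probability. -/
lemma le_returnProb_mul_growth {n : ℕ} {K : ℝ} (hn : 1 ≤ n)
    (hK : (growth R (2 * n + 1) : ℝ) ≤ K * growth R n) (hKn : K ≤ 2 * n ^ 2) (j : ℕ) :
    (1 - K / (2 * n ^ 2)) ^ (2 * j) ≤ growth R (2 * n) * returnProb R (2 * j) := by
  set f : PullSpace (basisVec (FreeGroup (Fin d) ⧸ R)) := tent R (2 * n) with hf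
  have hn0 : (0 : ℝ) < n := by exact_mod_cast hn
  have hV : (0 : ℝ) < growth R n := by exact_mod_cast growth_pos R n
  have hq := card_letter_pos (d := d)
  have hS := PullSpace.norm_sq_of_orthonormal (orthonormal_basisVec _) (tent R (2 * n))
  have h1 := le_sum_tent_sq R n
  rw [← hS] at h1
  have h2 := energy_tent_le R (2 * n)
  have h3 := norm_walkOp_pow_sq_le_card_mul R j (tent R (2 * n))
  rw [← hS] at h3
  change (n : ℝ) ^ 2 * growth R n ≤ ‖f‖ ^ 2 at h1
  change energy (regRep R) f ≤ _ at h2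
  change ‖(walkOp (regRep R) ^ j) f‖ ^ 2 ≤ _ * ‖f‖ ^ 2 * _ at h3
  have hf0 : 0 < ‖f‖ ^ 2 := lt_of_lt_of_le (by positivity) h1
  set θ : ℝ := 1 - K / (2 * n ^ 2) with hθ
  have hθ0 : 0 ≤ θ := by
    rw [hθ, sub_nonneg, div_le_one (by positivity)]
    exact hKn
  have hK0 : 0 ≤ K := by
    by_contra h
    have : K * growth R n < 0 := mul_neg_of_neg_of_pos (not_le.1 h) hV
    have h' : (0 : ℝ) ≤ growth R (2 * n + 1) := Nat.cast_nonneg _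
    linarith
  have h4 : θ * ‖f‖ ^ 2 ≤ ⟪walkOp (regRep R) f, f⟫_ℝ := by
    rw [energy_eq] at h2
    have h5 : ‖f‖ ^ 2 - ⟪walkOp (regRep R) f, f⟫_ℝ ≤ K * growth R n / 2 := by
      have h6 := h2.trans (mul_le_mul_of_nonneg_left hK hq.le)
      rw [mul_comm 2, mul_assoc] at h6
      have := le_of_mul_le_mul_left h6 hq
      linarith
    have h7 : K * growth R n / 2 ≤ K / (2 * n ^ 2) * ‖f‖ ^ 2 := by
      rw [div_mul_eq_mul_div, le_div_iff₀ (by positivity)]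
      nlinarith [mul_le_mul_of_nonneg_left h1 hK0]
    rw [hθ]
    linarith
  have h5 := pow_mul_norm_le_norm_walkOp_pow (regRep R) hθ0 h4 j
  have h6 : (θ ^ j * ‖f‖) ^ 2 ≤ ‖(walkOp (regRep R) ^ j) f‖ ^ 2 := by gcongr
  rw [mul_pow, ← pow_mul, mul_comm j] at h6
  have h7 := h6.trans h3
  have hp := returnProb_nonneg R (2 * j)
  have h8 : ((tent R (2 * n)).support.card : ℝ) ≤ growth R (2 * n) := by
    exact_mod_cast card_support_tent_le R (2 * n)
  refine le_of_mul_le_mul_right (h7.trans ?_) hf0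
  rw [mul_right_comm]
  gcongr

end Tent

section ReturnDoubling

lemma one_sub_pow_le_inv {x : ℝ} (hx0 : 0 ≤ x) (hx1 : x ≤ 1) (m : ℕ) :
    (1 - x) ^ m ≤ (1 + m * x)⁻¹ := by
  have h := one_add_mul_le_pow (a := x) (by linarith) m
  have hinv : 0 ≤ 1 - x := sub_nonneg.2 hx1
  rw [← one_div, le_div_iff₀ (by positivity)]
  calc (1 - x) ^ m * (1 + m * x) ≤ (1 - x) ^ m * (1 + x) ^ m := by gcongr
    _ = (1 - x ^ 2) ^ m := by rw [← mul_pow]; ring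
    _ ≤ 1 := pow_le_one₀ (by rw [sub_nonneg]; exact pow_le_one₀ hx0 hx1)
        (by linarith [sq_nonneg x])

variable (R : Subgroup (FreeGroup (Fin d))) [R.Normal]

lemma returnProb_add_le {n : ℕ} (hn : 1 ≤ n) (j m : ℕ) :
    returnProb R (2 * (j + m)) ≤ 2 / growth R n +
      (1 + m / (4 * n ^ 2 * Fintype.card (Letter d) ^ 2 : ℝ))⁻¹ * returnProb R (2 * j) := by
  have hn0 : (1 : ℝ) ≤ n := by exact_mod_cast hn
  have hq : (1 : ℝ) ≤ Fintype.card (Letter d) := by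
    exact_mod_cast Fintype.card_pos (α := Letter d)
  set t : ℝ := 4 * n ^ 2 * Fintype.card (Letter d) ^ 2 with ht
  have ht1 : 1 ≤ t := by
    have : (1 : ℝ) ≤ n ^ 2 := one_le_pow₀ hn0
    have : (1 : ℝ) ≤ Fintype.card (Letter d) ^ 2 := one_le_pow₀ hq
    nlinarith
  have ht0 : 0 < t := by linarith
  have hinv : 0 ≤ 1 - t⁻¹ := sub_nonneg.2 (inv_le_one_of_one_le₀ ht1)
  have hV : (0 : ℝ) ≤ 2 / growth R n := by positivity
  have step : ∀ i, returnProb R (2 * (j + i)) - 2 / growth R n ≤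
      (1 - t⁻¹) ^ i * (returnProb R (2 * j) - 2 / growth R n) := by
    intro i
    induction i with
    | zero => simp
    | succ i ih =>
      have h1 := returnProb_nash R (j + i) n
      rw [← ht] at h1
      have h2 : returnProb R (2 * (j + i + 1)) - 2 / growth R n ≤
          (1 - t⁻¹) * (returnProb R (2 * (j + i)) - 2 / growth R n) := by
        refine le_of_mul_le_mul_left ?_ ht0
        rw [← mul_assoc, mul_sub t 1, mul_one, mul_inv_cancel₀ ht0.ne']
        linarith
      rw [← add_assoc]
      refine h2.trans ?_
      rw [pow_succ', mul_assoc]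
      gcongr
  have h3 : (1 - t⁻¹) ^ m ≤ (1 + m / t)⁻¹ := by
    have := one_sub_pow_le_inv (inv_pos.2 ht0).le (inv_le_one_of_one_le₀ ht1) m
    rwa [← div_eq_mul_inv] at this
  have hp := returnProb_nonneg R (2 * j)
  have h4 : (1 - t⁻¹) ^ m * (returnProb R (2 * j) - 2 / growth R n) ≤
      (1 - t⁻¹) ^ m * returnProb R (2 * j) := by
    gcongr
    linarith
  have h5 : (1 - t⁻¹) ^ m * returnProb R (2 * j) ≤ (1 + m / t)⁻¹ * returnProb R (2 * j) := by
    gcongr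
  linarith [step m]

variable {M : ℕ} (hM : ∀ n : ℕ, 1 ≤ n → growth R (2 * n) ≤ M * growth R n)
include hM

lemma one_le_of_growth_doubling : 1 ≤ M := by
  by_contra h
  have h0 : M = 0 := by omega
  have h1 := hM 1 le_rfl
  have h2 := growth_pos R (2 * 1)
  rw [h0] at h1
  omega

lemma growth_two_pow_add_le (i b : ℕ) : growth R (2 ^ (i + b)) ≤ M ^ b * growth R (2 ^ i) := by
  induction b with
  | zero => simp
  | succ b ih =>
    rw [← add_assoc, pow_succ', pow_succ', mul_assoc]
    exact (hM _ Nat.one_le_two_pow).trans (Nat.mul_le_mul_left _ ih)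

lemma exists_le_returnProb_mul_growth :
    ∃ c : ℝ, 0 < c ∧ ∀ k : ℕ, c ≤ growth R (2 ^ k) * returnProb R (2 * 4 ^ k) := by
  have hM1 : (1 : ℝ) ≤ M := by exact_mod_cast one_le_of_growth_doubling R hM
  obtain ⟨b, hb⟩ := pow_unbounded_of_one_lt (2 * M : ℝ) (one_lt_two)
  refine ⟨1 / 2 / M ^ (b + 1), by positivity, fun k => ?_⟩
  rw [div_le_iff₀ (by positivity)]
  have hK : (growth R (2 * 2 ^ (k + b) + 1) : ℝ) ≤ (M : ℝ) ^ 2 * growth R (2 ^ (k + b)) := by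
    have h1 : growth R (2 * 2 ^ (k + b) + 1) ≤ growth R (2 ^ (k + b + 2)) := by
      refine growth_mono R ?_
      have := Nat.one_le_two_pow (n := k + b)
      rw [pow_add _ _ 2]
      omega
    exact_mod_cast h1.trans (growth_two_pow_add_le R hM (k + b) 2)
  have h4 : ((2 : ℝ) ^ (k + b)) ^ 2 = 4 ^ k * (2 ^ b) ^ 2 := by
    rw [pow_add, mul_pow, ← pow_mul, mul_comm k, pow_mul]; norm_num
  have hbb : (2 * M : ℝ) ^ 2 ≤ (2 ^ b) ^ 2 := by gcongr
  have h4k : (1 : ℝ) ≤ 4 ^ k := one_le_pow₀ (by norm_num)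
  have hx : (M : ℝ) ^ 2 / (2 * ((2 ^ (k + b) : ℕ) : ℝ) ^ 2) * (2 * 4 ^ k) ≤ 1 / 4 := by
    push_cast
    rw [h4, div_mul_eq_mul_div, div_le_iff₀ (by positivity)]
    nlinarith
  have hx1 : (M : ℝ) ^ 2 / (2 * ((2 ^ (k + b) : ℕ) : ℝ) ^ 2) ≤ 1 := by
    have : 0 ≤ (M : ℝ) ^ 2 / (2 * ((2 ^ (k + b) : ℕ) : ℝ) ^ 2) := by positivity
    nlinarith
  have h := le_returnProb_mul_growth R (n := 2 ^ (k + b)) Nat.one_le_two_pow hK (by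
    rwa [div_le_one (by positivity)] at hx1) (4 ^ k)
  set x := (M : ℝ) ^ 2 / (2 * ((2 ^ (k + b) : ℕ) : ℝ) ^ 2) with hxdef
  have h5 : (1 : ℝ) / 2 ≤ (1 - x) ^ (2 * 4 ^ k) := by
    have := one_add_mul_le_pow (a := -x) (by linarith) (2 * 4 ^ k)
    push_cast at this
    rw [← sub_eq_add_neg] at this
    linarith
  have h6 : (growth R (2 * 2 ^ (k + b)) : ℝ) ≤ M ^ (b + 1) * growth R (2 ^ k) := by
    rw [← pow_succ', add_assoc]
    exact_mod_cast growth_two_pow_add_le R hM k (b + 1)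
  have hp := returnProb_nonneg R (2 * 4 ^ k)
  calc (1 : ℝ) / 2 ≤ growth R (2 * 2 ^ (k + b)) * returnProb R (2 * 4 ^ k) := h5.trans h
    _ ≤ (M ^ (b + 1) * growth R (2 ^ k)) * returnProb R (2 * 4 ^ k) := by gcongr
    _ = _ := by ring

lemma exists_returnProb_mul_growth_le :
    ∃ C : ℝ, 0 < C ∧ ∀ k : ℕ, growth R (2 ^ k) * returnProb R (2 * 4 ^ k) ≤ C := by
  have hM1 : (1 : ℝ) ≤ M := by exact_mod_cast one_le_of_growth_doubling R hM
  have hq := card_letter_pos (d := d)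
  obtain ⟨a, ha⟩ := pow_unbounded_of_one_lt
    (4 * (Fintype.card (Letter d) : ℝ) ^ 2 * M) (show (1 : ℝ) < 4 by norm_num)
  refine ⟨4 * M ^ (a + 1) + growth R (2 ^ a), by positivity, fun k => ?_⟩
  have small : ∀ k ≤ a, growth R (2 ^ k) * returnProb R (2 * 4 ^ k) ≤
      4 * (M : ℝ) ^ (a + 1) + growth R (2 ^ a) := by
    intro k hk
    have h1 : returnProb R (2 * 4 ^ k) ≤ 1 := by
      have := returnProb_two_mul_anti R (Nat.zero_le (4 ^ k))
      rwa [mul_zero, returnProb_zero] at this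
    have h2 : (growth R (2 ^ k) : ℝ) ≤ growth R (2 ^ a) := by
      exact_mod_cast growth_mono R (Nat.pow_le_pow_right (by norm_num) hk)
    have h3 : growth R (2 ^ k) * returnProb R (2 * 4 ^ k) ≤ growth R (2 ^ k) :=
      mul_le_of_le_one_right (by positivity) h1
    have : (0 : ℝ) ≤ 4 * (M : ℝ) ^ (a + 1) := by positivity
    linarith
  rcases le_total k a with hk | hk
  · exact small k hk
  obtain ⟨i, rfl⟩ := Nat.exists_eq_add_of_le hk
  clear hk
  induction i with
  | zero => exact small a le_rfl
  | succ i ih =>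
    have h1 := returnProb_add_le R (n := 2 ^ i) Nat.one_le_two_pow (4 ^ (a + i)) (3 * 4 ^ (a + i))
    have e1 : 4 ^ (a + i) + 3 * 4 ^ (a + i) = 4 ^ (a + (i + 1)) := by
      rw [← add_assoc, pow_succ]; ring
    rw [e1] at h1
    have hp := returnProb_nonneg R (2 * 4 ^ (a + i))
    have h2 : (1 + ((3 * 4 ^ (a + i) : ℕ) : ℝ) /
        (4 * ((2 ^ i : ℕ) : ℝ) ^ 2 * Fintype.card (Letter d) ^ 2 : ℝ))⁻¹ ≤ (2 * (M : ℝ))⁻¹ := by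
      refine inv_anti₀ (by positivity) ?_
      have e2 : ((2 : ℝ) ^ i) ^ 2 = 4 ^ i := by
        rw [← pow_mul, mul_comm i, pow_mul]; norm_num
      have : 2 * (M : ℝ) ≤ ((3 * 4 ^ (a + i) : ℕ) : ℝ) /
          (4 * ((2 ^ i : ℕ) : ℝ) ^ 2 * Fintype.card (Letter d) ^ 2 : ℝ) := by
        push_cast
        rw [e2, le_div_iff₀ (by positivity), pow_add]
        have h4 : (0 : ℝ) < 4 ^ i := by positivity
        have h5 := mul_lt_mul_of_pos_right ha h4
        have h6 : (0 : ℝ) < 4 ^ a * 4 ^ i := by positivity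
        linarith
      linarith
    have h3 : (growth R (2 ^ (a + (i + 1))) : ℝ) ≤ M ^ (a + 1) * growth R (2 ^ i) := by
      rw [show a + (i + 1) = i + (a + 1) by ring]
      exact_mod_cast growth_two_pow_add_le R hM i (a + 1)
    have h4 : (growth R (2 ^ (a + (i + 1))) : ℝ) ≤ M * growth R (2 ^ (a + i)) := by
      have := growth_two_pow_add_le R hM (a + i) 1
      rw [pow_one, add_assoc] at this
      exact_mod_cast this
    have hV : (0 : ℝ) < growth R (2 ^ i) := by exact_mod_cast growth_pos R _
    calc growth R (2 ^ (a + (i + 1))) * returnProb R (2 * 4 ^ (a + (i + 1)))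
        ≤ growth R (2 ^ (a + (i + 1))) * (2 / growth R (2 ^ i) +
          (2 * (M : ℝ))⁻¹ * returnProb R (2 * 4 ^ (a + i))) := by
          gcongr
          refine h1.trans ?_
          gcongr
      _ = growth R (2 ^ (a + (i + 1))) * (2 / growth R (2 ^ i)) +
          growth R (2 ^ (a + (i + 1))) * ((2 * (M : ℝ))⁻¹ * returnProb R (2 * 4 ^ (a + i))) := by
          ring
      _ ≤ (M ^ (a + 1) * growth R (2 ^ i)) * (2 / growth R (2 ^ i)) +
          (M * growth R (2 ^ (a + i))) * ((2 * (M : ℝ))⁻¹ * returnProb R (2 * 4 ^ (a + i))) := by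
          gcongr
      _ = 2 * M ^ (a + 1) + (growth R (2 ^ (a + i)) * returnProb R (2 * 4 ^ (a + i))) / 2 := by
          field_simp
      _ ≤ _ := by
          have : (0 : ℝ) ≤ growth R (2 ^ a) := by positivity
          linarith

/-- The return probability of the lazy random walk is doubling. -/
theorem exists_returnProb_doubling :
    ∃ C : ℝ, 0 < C ∧ ∀ j : ℕ, 1 ≤ j → returnProb R (2 * j) ≤ C * returnProb R (2 * (2 * j)) := by
  have hM1 : (1 : ℝ) ≤ M := by exact_mod_cast one_le_of_growth_doubling R hM
  obtain ⟨c, hc0, hc⟩ := exists_le_returnProb_mul_growth R hM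
  obtain ⟨C, hC0, hC⟩ := exists_returnProb_mul_growth_le R hM
  refine ⟨C * M ^ 2 / c, by positivity, fun j hj => ?_⟩
  set k := Nat.log 4 j
  have h1 : 4 ^ k ≤ j := Nat.pow_log_le_self 4 (by omega)
  have h2 : j < 4 ^ (k + 1) := Nat.lt_pow_succ_log_self (by norm_num) j
  have h3 := returnProb_two_mul_anti R h1
  have h4 : returnProb R (2 * 4 ^ (k + 2)) ≤ returnProb R (2 * (2 * j)) :=
    returnProb_two_mul_anti R (by rw [pow_succ 4 (k + 1)]; omega)
  have hV : (0 : ℝ) < growth R (2 ^ k) := by exact_mod_cast growth_pos R _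
  have h5 : (growth R (2 ^ (k + 2)) : ℝ) ≤ M ^ 2 * growth R (2 ^ k) := by
    exact_mod_cast growth_two_pow_add_le R hM k 2
  have h6 := hc (k + 2)
  have h7 := hC k
  have hp := returnProb_nonneg R (2 * 4 ^ (k + 2))
  have h8 : c ≤ M ^ 2 * growth R (2 ^ k) * returnProb R (2 * (2 * j)) :=
    h6.trans (by gcongr)
  rw [div_mul_eq_mul_div, le_div_iff₀ hc0]
  have h9 : growth R (2 ^ k) * returnProb R (2 * j) ≤ C := le_trans (by gcongr) h7
  have hp2 := returnProb_nonneg R (2 * j)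
  calc returnProb R (2 * j) * c
      ≤ returnProb R (2 * j) * (M ^ 2 * growth R (2 ^ k) * returnProb R (2 * (2 * j))) := by gcongr
    _ = (growth R (2 ^ k) * returnProb R (2 * j)) * (M ^ 2 * returnProb R (2 * (2 * j))) := by ring
    _ ≤ C * (M ^ 2 * returnProb R (2 * (2 * j))) := by
        have := returnProb_nonneg R (2 * (2 * j))
        gcongr
    _ = _ := by ring

end ReturnDoubling

section TwistedAverage

open scoped InnerProductSpace

variable (R : Subgroup (FreeGroup (Fin d)))

lemma one_le_card_letter : (1 : ℝ) ≤ Fintype.card (Letter d) := by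
  exact_mod_cast Fintype.card_pos (α := Letter d)

lemma returnProb_le_card_mul_succ (n : ℕ) :
    returnProb R n ≤ Fintype.card (Letter d) * returnProb R (n + 1) := by
  classical
  have hq := card_letter_pos (d := d)
  have h : (∑ w : Fin n → Letter d, if partialProd w n ∈ R then (1 : ℝ) else 0) ≤
      ∑ w : Fin (n + 1) → Letter d, if partialProd w (n + 1) ∈ R then (1 : ℝ) else 0 := by
    rw [← (Fin.consEquiv fun _ => Letter d).sum_comp, Fintype.sum_prod_type]
    refine le_trans (le_of_eq ?_) (Finset.single_le_sum (fun a _ => ?_) (Finset.mem_univ none))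
    · refine Finset.sum_congr rfl fun w _ => ?_
      have h := partialProd_cons none w
      rw [letterVal, one_mul] at h
      rw [← h]
      rfl
    · positivity
  rw [returnProb, returnProb, pow_succ, mul_inv, mul_comm _ (_⁻¹ : ℝ), mul_assoc, ← mul_assoc,
    mul_inv_cancel₀ hq.ne', one_mul]
  gcongr

lemma returnProb_le_card_pow_mul_add (n i : ℕ) :
    returnProb R n ≤ (Fintype.card (Letter d) : ℝ) ^ i * returnProb R (n + i) := by
  induction i with
  | zero => simp
  | succ i ih =>
    rw [pow_succ, mul_assoc, ← add_assoc]
    exact ih.trans (by gcongr; exact returnProb_le_card_mul_succ R _)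

variable {R} {φ : FreeGroup (Fin d) → ℝ} (hφ : ∀ x ∈ R, ∀ y ∈ R, φ (x * y) = φ x + φ y)

open scoped Classical in
lemma inner_walkOp_pow_twisted (n : ℕ) :
    ⟪(walkOp (twistedRep hφ) ^ n) (pointMass _ 1), pointMass _ 1⟫_ℝ =
      ((Fintype.card (Letter d) : ℝ) ^ n)⁻¹ *
        ∑ w : Fin n → Letter d,
          if partialProd w n ∈ R then Real.cos (φ (partialProd w n)) else 0 := by
  rw [walkOp_pow_apply, real_inner_smul_left, sum_inner]
  simp only [inner_twistedRep_pointMass hφ]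

lemma inner_walkOp_pow_twisted_le (n : ℕ) :
    ⟪(walkOp (twistedRep hφ) ^ n) (pointMass _ 1), pointMass _ 1⟫_ℝ ≤ returnProb R n := by
  rw [inner_walkOp_pow_twisted, returnProb]
  gcongr with w
  split_ifs
  · exact Real.cos_le_one _
  · exact le_rfl

lemma inner_walkOp_pow_twisted_le_of_gap {γ : ℝ} (hγ : 0 ≤ γ) (hγ1 : γ ≤ 1)
    (h : ∀ f, ‖walkOp (twistedRep hφ) f‖ ^ 2 ≤ γ * ‖f‖ ^ 2) (j i : ℕ) :
    ⟪(walkOp (twistedRep hφ) ^ (4 * j + i)) (pointMass _ 1), pointMass _ 1⟫_ℝ ≤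
      γ ^ j * returnProb R (2 * j) := by
  set T := walkOp (twistedRep hφ) with hT
  set v := pointMass (twistedVec R φ) 1
  have h1 : ‖(T ^ (2 * j + i + j)) v‖ ≤ γ ^ j * ‖(T ^ j) v‖ := by
    rw [pow_add T, Module.End.mul_apply]
    refine le_of_sq_le_sq ?_ (by positivity)
    refine (norm_walkOp_pow_sq_le _ hγ h _ _).trans ?_
    rw [mul_pow, ← pow_mul, mul_comm j 2]
    exact mul_le_mul_of_nonneg_right (pow_le_pow_of_le_one hγ hγ1 (Nat.le_add_right _ _))
      (sq_nonneg _)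
  rw [show 4 * j + i = (2 * j + i + j) + j by ring, ← inner_walkOp_pow]
  calc _ ≤ ‖(T ^ (2 * j + i + j)) v‖ * ‖(T ^ j) v‖ := real_inner_le_norm _ _
    _ ≤ γ ^ j * ‖(T ^ j) v‖ * ‖(T ^ j) v‖ := by gcongr
    _ = γ ^ j * ‖(T ^ j) v‖ ^ 2 := by ring
    _ ≤ _ := by
      rw [norm_walkOp_pow_sq]
      gcongr
      exact inner_walkOp_pow_twisted_le hφ _

open scoped Classical in
theorem exists_half_card_le_sum_abs [R.Normal] {C : ℝ} (hC0 : 0 < C)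
    (hC : ∀ j, 1 ≤ j → returnProb R (2 * j) ≤ C * returnProb R (2 * (2 * j))) :
    ∃ ε : ℝ, 0 < ε ∧ ∀ φ : FreeGroup (Fin d) → ℝ,
      (∀ x ∈ R, ∀ y ∈ R, φ (x * y) = φ x + φ y) → (∀ x ∈ R, ∀ y, φ (y⁻¹ * x * y) = φ x) →
      ∀ z ∈ R, φ z = Real.pi → ∀ n : ℕ, 4 ≤ n → (z.norm : ℝ) ≤ ε * √n →
      1 / 2 * (∑ w : Fin n → Letter d, if partialProd w n ∈ R then (1 : ℝ) else 0) ≤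
        ∑ w : Fin n → Letter d, if partialProd w n ∈ R then |φ (partialProd w n)| else 0 := by
  have hq1 := one_le_card_letter (d := d)
  set q : ℝ := (Fintype.card (Letter d) : ℝ) with hq
  have hq0 : 0 < q := by linarith
  refine ⟨√(1 / (8 * C * q ^ 5)), by positivity, fun φ hφ hconj z hz hzφ n hn hzn => ?_⟩
  have hn0 : (0 : ℝ) < n := by exact_mod_cast (by omega : 0 < n)
  obtain ⟨l, hl, hlz⟩ := exists_letters_eq z
  set m : ℝ := √(1 / (8 * C * q ^ 5)) * √n with hm
  have hm0 : 0 < m := by positivity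
  have hm2 : m ^ 2 = n / (8 * C * q ^ 5) := by
    rw [hm, mul_pow, Real.sq_sqrt (by positivity), Real.sq_sqrt hn0.le]; ring
  have hgap := norm_walkOp_sq_le (twistedRep hφ) (l := l)
    (fun f => by rw [hlz]; exact norm_twistedRep_add_eq_zero hφ hconj hz hzφ f) hm0
    (by rw [hl]; exact hzn)
  rw [← hq] at hgap
  set x : ℝ := 2 / (q ^ 2 * m ^ 2) with hx
  have hx0 : 0 ≤ x := by positivity
  have hx1 : x ≤ 1 := by
    have h := hgap (pointMass _ 1)
    rw [norm_pointMass_twisted hφ] at h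
    nlinarith [sq_nonneg ‖walkOp (twistedRep hφ) (pointMass _ 1)‖]
  have hj : 1 ≤ n / 4 := by omega
  have hsplit : n = 4 * (n / 4) + n % 4 := (Nat.div_add_mod n 4).symm
  set j := n / 4
  have hmain := inner_walkOp_pow_twisted_le_of_gap hφ (sub_nonneg.2 hx1) (by linarith) hgap j
    (n % 4)
  rw [← hsplit] at hmain
  have hxj : 2 * C * q ^ 3 ≤ j * x := by
    have h8 : (n : ℝ) ≤ 8 * j := by exact_mod_cast (by omega : n ≤ 8 * j)
    rw [hx, hm2, ← mul_div_assoc, le_div_iff₀ (by positivity)]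
    rw [show 2 * C * q ^ 3 * (q ^ 2 * (n / (8 * C * q ^ 5))) = n / 4 by field_simp; ring]
    linarith
  have hret : returnProb R (2 * j) ≤ C * q ^ 3 * returnProb R n := by
    have h1 := returnProb_le_card_pow_mul_add R (2 * (2 * j)) (n % 4)
    rw [← mul_assoc, ← hq, show 2 * 2 = 4 by norm_num, ← hsplit] at h1
    have h2 : q ^ (n % 4) ≤ q ^ 3 := pow_le_pow_right₀ hq1 (by omega)
    have h3 := returnProb_nonneg R n
    calc returnProb R (2 * j) ≤ C * returnProb R (2 * (2 * j)) := hC j hj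
      _ ≤ C * (q ^ 3 * returnProb R n) := by
        rw [← mul_assoc]
        gcongr
        exact h1.trans (by gcongr)
      _ = _ := by ring
  have hhalf : (1 - x) ^ j * (C * q ^ 3) ≤ 1 / 2 := by
    calc (1 - x) ^ j * (C * q ^ 3) ≤ (1 + j * x)⁻¹ * (C * q ^ 3) := by
          gcongr
          exact one_sub_pow_le_inv hx0 hx1 j
      _ ≤ 1 / 2 := by
          rw [inv_mul_le_iff₀ (by positivity)]
          linarith
  have hfin : ⟪(walkOp (twistedRep hφ) ^ n) (pointMass _ 1), pointMass _ 1⟫_ℝ ≤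
      1 / 2 * returnProb R n := by
    have h3 := returnProb_nonneg R n
    have h4 : 0 ≤ (1 - x) ^ j := pow_nonneg (sub_nonneg.2 hx1) _
    calc _ ≤ (1 - x) ^ j * returnProb R (2 * j) := hmain
      _ ≤ (1 - x) ^ j * (C * q ^ 3 * returnProb R n) := by gcongr
      _ = (1 - x) ^ j * (C * q ^ 3) * returnProb R n := by ring
      _ ≤ _ := by gcongr
  rw [inner_walkOp_pow_twisted, returnProb, mul_left_comm] at hfin
  have hcos := le_of_mul_le_mul_left hfin (by positivity)
  have hsum : (∑ w : Fin n → Letter d, if partialProd w n ∈ R then (1 : ℝ) else 0) ≤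
      (∑ w : Fin n → Letter d,
        if partialProd w n ∈ R then Real.cos (φ (partialProd w n)) else 0) +
      ∑ w : Fin n → Letter d, if partialProd w n ∈ R then |φ (partialProd w n)| else 0 := by
    rw [← Finset.sum_add_distrib]
    refine Finset.sum_le_sum fun w _ => ?_
    split_ifs
    · set y := φ (partialProd w n)
      rcases le_total |y| 2 with h | h
      · have := Real.one_sub_sq_div_two_le_cos (x := y)
        rw [← sq_abs] at this
        nlinarith [abs_nonneg y]
      · linarith [Real.neg_one_le_cos y]
    · simp
  linarith

end TwistedAverage

section Subadditive

lemma subadditive_zpow_le {A : Type*} [Group A] {ν : A → ℕ} (hν : ∀ x y, ν (x * y) ≤ ν x + ν y)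
    (x : A) (n : ℤ) : ν (x ^ n) ≤ ν 1 + n.natAbs * (ν x + ν x⁻¹) := by
  have hpow : ∀ (y : A) (m : ℕ), ν (y ^ m) ≤ ν 1 + m * ν y := by
    intro y m
    induction m with
    | zero => simp
    | succ m ih =>
      rw [pow_succ]
      have := hν (y ^ m) y
      linarith
  rcases Int.natAbs_eq n with h | h <;> rw [h]
  · rw [zpow_natCast, Int.natAbs_natCast]
    exact (hpow x _).trans (by gcongr; omega)
  · rw [zpow_neg, zpow_natCast, ← inv_pow, Int.natAbs_neg, Int.natAbs_natCast]
    exact (hpow x⁻¹ _).trans (by gcongr; omega)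

lemma subadditive_prod_le {A ι : Type*} [CommGroup A] {ν : A → ℕ}
    (hν : ∀ x y, ν (x * y) ≤ ν x + ν y) (s : Finset ι) (f : ι → A) :
    ν (∏ i ∈ s, f i) ≤ ν 1 + ∑ i ∈ s, ν (f i) := by
  classical
  induction s using Finset.induction_on with
  | empty => simp
  | insert i s hi ih =>
    rw [Finset.prod_insert hi, Finset.sum_insert hi]
    have := hν (f i) (∏ i ∈ s, f i)
    omega

/-- On a finitely generated abelian group, a subadditive function is bounded by an affine function
of finitely many integral characters. -/
theorem exists_characters_bound {A : Type*} [CommGroup A] [Group.FG A] {ν : A → ℕ}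
    (hν : ∀ x y, ν (x * y) ≤ ν x + ν y) :
    ∃ (ι : Type) (_ : Fintype ι) (f : ι → A →* Multiplicative ℤ) (C : ℕ),
      ∀ a, ν a ≤ C * (1 + ∑ i, (f i a).toAdd.natAbs) := by
  obtain ⟨κ, ι, hκ, hι, p, hp, e, ⟨E⟩⟩ := CommGroup.equiv_free_prod_prod_multiplicative_zmod A
  have hfin : Finite ((i : κ) → Multiplicative (ZMod (p i ^ e i))) := by
    have : ∀ i, NeZero (p i ^ e i) := fun i => ⟨pow_ne_zero _ (hp i).ne_zero⟩
    have : ∀ i, Finite (Multiplicative (ZMod (p i ^ e i))) := fun i =>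
      inferInstanceAs (Finite (ZMod (p i ^ e i)))
    infer_instance
  classical
  obtain ⟨T, hT⟩ := (Set.finite_range fun t : (i : κ) → Multiplicative (ZMod (p i ^ e i)) =>
    ν (E.symm (1, t))).bddAbove
  let x : ι → A := fun j => E.symm (Pi.mulSingle j (Multiplicative.ofAdd 1), 1)
  let K := ∑ j, (ν (x j) + ν (x j)⁻¹)
  refine ⟨ι, inferInstance, fun j => ((Pi.evalMonoidHom _ j).comp (MonoidHom.fst _ _)).comp
    E.toMonoidHom, T + ν 1 + Fintype.card ι * ν 1 + K, fun a => ?_⟩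
  have hfree : E.symm ((E a).1, 1) = ∏ j, x j ^ ((E a).1 j).toAdd := by
    have h1 : (E a).1 = ∏ j : ι, (Pi.mulSingle j (Multiplicative.ofAdd (1 : ℤ)) :
        ι → Multiplicative ℤ) ^ ((E a).1 j).toAdd := by
      conv_lhs => rw [← Finset.univ_prod_mulSingle (E a).1]
      refine Finset.prod_congr rfl fun j _ => ?_
      rw [← Pi.mulSingle_zpow, ← ofAdd_zsmul]
      simp
    rw [E.symm_apply_eq, map_prod]
    simp only [map_zpow, x, E.apply_symm_apply]
    ext1
    · rw [Prod.fst_prod]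
      exact h1
    · rw [Prod.snd_prod]
      simp
  have ha : a = E.symm ((E a).1, 1) * E.symm (1, (E a).2) := by
    rw [← map_mul]; simp
  have h1 : ν (E.symm (1, (E a).2)) ≤ T := hT ⟨_, rfl⟩
  have h2 : ν (E.symm ((E a).1, 1)) ≤
      ν 1 + (Fintype.card ι * ν 1 + K * ∑ j, ((E a).1 j).toAdd.natAbs) := by
    rw [hfree]
    refine (subadditive_prod_le hν _ _).trans ?_
    gcongr
    calc ∑ j, ν (x j ^ ((E a).1 j).toAdd)
        ≤ ∑ j, (ν 1 + ((E a).1 j).toAdd.natAbs * K) := by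
          refine Finset.sum_le_sum fun j _ => (subadditive_zpow_le hν _ _).trans ?_
          gcongr
          exact Finset.single_le_sum (f := fun j => ν (x j) + ν (x j)⁻¹)
            (fun _ _ => Nat.zero_le _) (Finset.mem_univ j)
      _ = _ := by
          rw [Finset.sum_add_distrib, ← Finset.sum_mul, mul_comm K]
          simp
  have h3 : ν a ≤ _ := (congrArg ν ha).le.trans (hν _ _)
  change ν a ≤ (T + ν 1 + Fintype.card ι * ν 1 + K) * (1 + ∑ j, ((E a).1 j).toAdd.natAbs)
  set S := ∑ j, ((E a).1 j).toAdd.natAbs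
  calc ν a ≤ T + ν 1 + Fintype.card ι * ν 1 + K * S := by linarith
    _ ≤ T + ν 1 + Fintype.card ι * ν 1 + K * S +
        ((T + ν 1 + Fintype.card ι * ν 1) * S + K) := Nat.le_add_right _ _
    _ = _ := by ring

end Subadditive

section Filling

variable (r : Fin s → FreeGroup (Fin d))

lemma relator_mem (i : Fin s) : r i ∈ relSubgroup r := Subgroup.subset_normalClosure ⟨i, rfl⟩

lemma exists_fillingArea_eq {w : FreeGroup (Fin d)} (hw : w ∈ relSubgroup r) :
    ∃ (g : Fin (fillingArea r w) → FreeGroup (Fin d)) (a : Fin (fillingArea r w) → Fin s)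
      (ε : Fin (fillingArea r w) → Bool),
      w = (List.ofFn fun i => (g i)⁻¹ * (r (a i)) ^ (if ε i then (1 : ℤ) else -1) * g i).prod := by
  refine Nat.sInf_mem (s := { k | ∃ (g : Fin k → FreeGroup (Fin d)) (a : Fin k → Fin s)
    (ε : Fin k → Bool), w = (List.ofFn fun i =>
      (g i)⁻¹ * (r (a i)) ^ (if ε i then (1 : ℤ) else -1) * g i).prod }) ?_
  rw [relSubgroup, Subgroup.normalClosure] at hw
  have step : ∀ (b : Bool) (x : FreeGroup (Fin d)), x ∈ Group.conjugatesOfSet (Set.range r) →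
      ∃ c i, x ^ (if b then (1 : ℤ) else -1) =
        c⁻¹ * (r i) ^ (if b then (1 : ℤ) else -1) * c := by
    intro b x hx
    obtain ⟨_, ⟨i, rfl⟩, hx⟩ := Group.mem_conjugatesOfSet_iff.1 hx
    obtain ⟨c, rfl⟩ := isConj_iff.1 hx
    refine ⟨c⁻¹, i, ?_⟩
    cases b <;> simp [mul_assoc]
  have cons : ∀ (b : Bool) (x y : FreeGroup (Fin d)), x ∈ Group.conjugatesOfSet (Set.range r) →
      (∃ k, ∃ (g : Fin k → FreeGroup (Fin d)) (a : Fin k → Fin s) (ε : Fin k → Bool),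
        y = (List.ofFn fun i =>
          (g i)⁻¹ * (r (a i)) ^ (if ε i then (1 : ℤ) else -1) * g i).prod) →
      ∃ k, ∃ (g : Fin k → FreeGroup (Fin d)) (a : Fin k → Fin s) (ε : Fin k → Bool),
        x ^ (if b then (1 : ℤ) else -1) * y = (List.ofFn fun i =>
          (g i)⁻¹ * (r (a i)) ^ (if ε i then (1 : ℤ) else -1) * g i).prod := by
    rintro b x y hx ⟨k, g, a, ε, rfl⟩
    obtain ⟨c, i, hc⟩ := step b x hx
    exact ⟨k + 1, Fin.cons c g, Fin.cons i a, Fin.cons b ε, by simp [List.ofFn_succ, hc]⟩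
  induction hw using Subgroup.closure_induction_left with
  | one => exact ⟨0, Fin.elim0, Fin.elim0, Fin.elim0, by simp⟩
  | mul_left x hx y hy ih =>
    have h := cons true x y hx ih
    rw [show (if (true : Bool) then (1 : ℤ) else -1) = 1 from rfl, zpow_one] at h
    exact h
  | inv_mul_cancel x hx y hy ih =>
    have h := cons false x y hx ih
    rw [show (if (false : Bool) then (1 : ℤ) else -1) = -1 from rfl, zpow_neg_one] at h
    exact h

variable {r} {φ : FreeGroup (Fin d) → ℝ}

lemma abs_le_mul_fillingArea
    (hφ : ∀ x ∈ relSubgroup r, ∀ y ∈ relSubgroup r, φ (x * y) = φ x + φ y)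
    (hconj : ∀ x ∈ relSubgroup r, ∀ y, φ (y⁻¹ * x * y) = φ x) {B : ℝ}
    (hB : ∀ i, |φ (r i)| ≤ B) {w : FreeGroup (Fin d)} (hw : w ∈ relSubgroup r) :
    |φ w| ≤ B * fillingArea r w := by
  obtain ⟨g, a, ε, h⟩ := exists_fillingArea_eq r hw
  have hrel : ∀ i, (r (a i)) ^ (if ε i then (1 : ℤ) else -1) ∈ relSubgroup r :=
    fun i => Subgroup.zpow_mem _ (relator_mem r _) _
  have hletter : ∀ i, |φ ((g i)⁻¹ * (r (a i)) ^ (if ε i then (1 : ℤ) else -1) * g i)| ≤ B := by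
    intro i
    rw [hconj _ (hrel i)]
    cases ε i
    · simpa [map_inv_of_add hφ (relator_mem r _)] using hB (a i)
    · simpa using hB (a i)
  have hlist : ∀ L : List (FreeGroup (Fin d)), (∀ x ∈ L, x ∈ relSubgroup r ∧ |φ x| ≤ B) →
      |φ L.prod| ≤ B * L.length := by
    intro L hL
    induction L with
    | nil => simp [map_one_of_add hφ]
    | cons x L ih =>
      have hx := hL x List.mem_cons_self
      have hL' : ∀ y ∈ L, y ∈ relSubgroup r ∧ |φ y| ≤ B := fun y hy =>
        hL y (List.mem_cons_of_mem _ hy)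
      rw [List.prod_cons, hφ _ hx.1 _ (Subgroup.list_prod_mem _ fun y hy => (hL' y hy).1)]
      refine (abs_add_le _ _).trans ?_
      push_cast [List.length_cons]
      linarith [ih hL', hx.2]
  have := hlist _ (List.forall_mem_ofFn_iff.2 fun i => ⟨?_, hletter i⟩)
  · rwa [← h, List.length_ofFn] at this
  · simpa only [inv_inv] using (inferInstance : (relSubgroup r).Normal).conj_mem _ (hrel i) (g i)⁻¹

variable (r)

instance commRF_normal : (commRF r).Normal := Subgroup.commutator_normal _ _

lemma conj_inv_mul_mem_commRF {x : FreeGroup (Fin d)} (hx : x ∈ relSubgroup r)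
    (y : FreeGroup (Fin d)) : (y⁻¹ * x * y)⁻¹ * x ∈ commRF r := by
  rw [commRF, Subgroup.commutator_comm]
  have h := Subgroup.commutator_mem_commutator (Subgroup.mem_top y⁻¹) (Subgroup.inv_mem _ hx)
  convert h using 1
  rw [commutatorElement_def]
  group

lemma mul_comm_inv_mul_mem_commRF {x : FreeGroup (Fin d)} (hx : x ∈ relSubgroup r)
    (y : FreeGroup (Fin d)) : (x * y)⁻¹ * (y * x) ∈ commRF r := by
  rw [commRF, Subgroup.commutator_comm]
  have h := Subgroup.commutator_mem_commutator (Subgroup.mem_top y⁻¹) (Subgroup.inv_mem _ hx)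
  convert h using 1
  rw [commutatorElement_def]
  group

lemma exists_centFillingArea_eq {w : FreeGroup (Fin d)} (hw : w ∈ relSubgroup r) :
    ∃ (a : Fin (centFillingArea r w) → Fin s) (ε : Fin (centFillingArea r w) → Bool),
      ((List.ofFn fun i => (r (a i)) ^ (if ε i then (1 : ℤ) else -1)).prod)⁻¹ * w ∈
        commRF r := by
  refine Nat.sInf_mem (s := { k | ∃ (a : Fin k → Fin s) (ε : Fin k → Bool),
    ((List.ofFn fun i => (r (a i)) ^ (if ε i then (1 : ℤ) else -1)).prod)⁻¹ * w ∈ commRF r }) ?_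
  obtain ⟨g, a, ε, h⟩ := exists_fillingArea_eq r hw
  refine ⟨_, a, ε, ?_⟩
  rw [← QuotientGroup.eq]
  have hrel : ∀ i, (r (a i)) ^ (if ε i then (1 : ℤ) else -1) ∈ relSubgroup r :=
    fun i => Subgroup.zpow_mem _ (relator_mem r _) _
  conv_rhs => rw [h]
  change QuotientGroup.mk' (commRF r) _ = QuotientGroup.mk' (commRF r) _
  rw [map_list_prod, map_list_prod, List.map_ofFn, List.map_ofFn]
  congr 2
  ext1 i
  exact (QuotientGroup.eq.2 (conj_inv_mul_mem_commRF r (hrel i) (g i))).symm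

lemma centFillingArea_mul_le {x y : FreeGroup (Fin d)} (hx : x ∈ relSubgroup r)
    (hy : y ∈ relSubgroup r) :
    centFillingArea r (x * y) ≤ centFillingArea r x + centFillingArea r y := by
  obtain ⟨a, ε, h⟩ := exists_centFillingArea_eq r hx
  obtain ⟨b, η, h'⟩ := exists_centFillingArea_eq r hy
  refine Nat.sInf_le ⟨Fin.append a b, Fin.append ε η, ?_⟩
  have e : (fun i => (r (Fin.append a b i)) ^ (if Fin.append ε η i then (1 : ℤ) else -1)) =
      Fin.append (fun i => (r (a i)) ^ (if ε i then (1 : ℤ) else -1))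
        (fun i => (r (b i)) ^ (if η i then (1 : ℤ) else -1)) := by
    ext1 i
    refine Fin.addCases (fun i => ?_) (fun i => ?_) i <;> simp
  rw [e, List.ofFn_fin_append, List.prod_append]
  rw [← QuotientGroup.eq] at h h' ⊢
  rw [QuotientGroup.mk_mul, QuotientGroup.mk_mul, h, h']

lemma centFillingArea_congr {x y : FreeGroup (Fin d)} (h : x⁻¹ * y ∈ commRF r) :
    centFillingArea r x = centFillingArea r y := by
  rw [← QuotientGroup.eq] at h
  simp only [centFillingArea, ← QuotientGroup.eq, h]

/-- The quotient of `R` by `[R,F]`. -/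
abbrev RelQuot := relSubgroup r ⧸ (commRF r).subgroupOf (relSubgroup r)

instance : CommGroup (RelQuot r) where
  mul_comm a b := by
    induction a using QuotientGroup.induction_on with
    | H x =>
    induction b using QuotientGroup.induction_on with
    | H y =>
    rw [← QuotientGroup.mk_mul, ← QuotientGroup.mk_mul, QuotientGroup.eq, Subgroup.mem_subgroupOf]
    exact mul_comm_inv_mul_mem_commRF r x.2 y.1

instance : Group.FG (RelQuot r) := by
  let ρ : Fin s → relSubgroup r := fun i => ⟨r i, relator_mem r i⟩
  refine Group.fg_of_surjective (f := FreeGroup.lift fun i => (ρ i : RelQuot r)) fun z => ?_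
  induction z using QuotientGroup.induction_on with
  | H z =>
  obtain ⟨a, ε, h⟩ := exists_centFillingArea_eq r z.2
  have hz : (z : RelQuot r) = QuotientGroup.mk' ((commRF r).subgroupOf (relSubgroup r))
      (List.ofFn fun i => (ρ (a i)) ^ (if ε i then (1 : ℤ) else -1)).prod := by
    refine (QuotientGroup.eq.2 ?_).symm
    rw [Subgroup.mem_subgroupOf]
    simpa only [Subgroup.coe_mul, Subgroup.coe_inv, Subgroup.val_list_prod, List.map_ofFn,
      Function.comp_def, Subgroup.coe_zpow, ρ] using h
  rw [← MonoidHom.mem_range, hz, map_list_prod]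
  refine Subgroup.list_prod_mem _ fun x hx => ?_
  obtain ⟨y, hy, rfl⟩ := List.mem_map.1 hx
  obtain ⟨i, rfl⟩ := List.mem_ofFn.1 hy
  rw [map_zpow]
  exact Subgroup.zpow_mem _ (MonoidHom.mem_range.2 ⟨FreeGroup.of (a i), by simp⟩) _

end Filling

section Characters

variable (r : Fin s → FreeGroup (Fin d))

open scoped Classical in
/-- The real-valued function on the free group which extends a character of `R / [R,F]` by zero. -/
noncomputable def charFun (f : RelQuot r →* Multiplicative ℤ) (x : FreeGroup (Fin d)) : ℝ :=
  if h : x ∈ relSubgroup r then ((f (⟨x, h⟩ : relSubgroup r)).toAdd : ℝ) else 0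

lemma charFun_mul (f : RelQuot r →* Multiplicative ℤ) :
    ∀ x ∈ relSubgroup r, ∀ y ∈ relSubgroup r,
      charFun r f (x * y) = charFun r f x + charFun r f y := by
  intro x hx y hy
  rw [charFun, charFun, charFun, dif_pos hx, dif_pos hy, dif_pos (mul_mem hx hy),
    ← MulMemClass.mk_mul_mk _ x y hx hy, QuotientGroup.mk_mul, map_mul, toAdd_mul, Int.cast_add]

lemma charFun_conj (f : RelQuot r →* Multiplicative ℤ) :
    ∀ x ∈ relSubgroup r, ∀ y, charFun r f (y⁻¹ * x * y) = charFun r f x := by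
  intro x hx y
  have hxy : y⁻¹ * x * y ∈ relSubgroup r := by
    simpa using (inferInstance : (relSubgroup r).Normal).conj_mem _ hx y⁻¹
  have h : ((⟨y⁻¹ * x * y, hxy⟩ : relSubgroup r) : RelQuot r) = (⟨x, hx⟩ : relSubgroup r) := by
    rw [QuotientGroup.eq, Subgroup.mem_subgroupOf]
    exact conj_inv_mul_mem_commRF r hx y
  rw [charFun, charFun, dif_pos hx, dif_pos hxy, h]

/-- The centralized filling area is detected by finitely many characters of `R / [R,F]`, which
bound the filling area from below. -/
theorem exists_character_lower_bound :
    ∃ B : ℝ, 0 < B ∧ ∃ C : ℝ, 0 < C ∧ ∀ z ∈ relSubgroup r, ∃ φ : FreeGroup (Fin d) → ℝ,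
      (∀ x ∈ relSubgroup r, ∀ y ∈ relSubgroup r, φ (x * y) = φ x + φ y) ∧
      (∀ x ∈ relSubgroup r, ∀ y, φ (y⁻¹ * x * y) = φ x) ∧
      (∀ w ∈ relSubgroup r, |φ w| ≤ B * fillingArea r w) ∧
      centFillingArea r z ≤ C * (1 + φ z) := by
  obtain ⟨ι, hι, f, C, hC⟩ := exists_characters_bound
    (ν := fun a : RelQuot r => centFillingArea r (Quotient.out a).1) (by
      intro a b
      refine (centFillingArea_congr r ?_).trans_le
        (centFillingArea_mul_le r (Quotient.out a).2 (Quotient.out b).2)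
      have : ((Quotient.out (a * b) : relSubgroup r) : RelQuot r) =
          ((Quotient.out a * Quotient.out b : relSubgroup r) : RelQuot r) := by
        rw [QuotientGroup.mk_mul, QuotientGroup.out_eq', QuotientGroup.out_eq',
          QuotientGroup.out_eq']
      rw [QuotientGroup.eq, Subgroup.mem_subgroupOf] at this
      exact this)
  let B : ℝ := 1 + ∑ i, ∑ j, |charFun r (f i) (r j)|
  have hB : ∀ i j, |charFun r (f i) (r j)| ≤ B := by
    intro i j
    have h1 := Finset.single_le_sum (f := fun j => |charFun r (f i) (r j)|)
      (fun _ _ => abs_nonneg _) (Finset.mem_univ j)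
    have h2 := Finset.single_le_sum (f := fun i => ∑ j, |charFun r (f i) (r j)|)
      (fun _ _ => Finset.sum_nonneg fun _ _ => abs_nonneg _) (Finset.mem_univ i)
    simp only [B]
    linarith
  have hB0 : 0 < B := by
    have : 0 ≤ ∑ i, ∑ j, |charFun r (f i) (r j)| :=
      Finset.sum_nonneg fun _ _ => Finset.sum_nonneg fun _ _ => abs_nonneg _
    linarith
  refine ⟨B, hB0, C * (1 + Fintype.card ι) + 1, by positivity, fun z hz => ?_⟩
  have hz1 : (centFillingArea r z : ℝ) ≤ C * (1 + ∑ i, |charFun r (f i) z|) := by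
    have h1 := hC (⟨z, hz⟩ : relSubgroup r)
    have h2 : centFillingArea r (Quotient.out ((⟨z, hz⟩ : relSubgroup r) : RelQuot r)).1 =
        centFillingArea r z := by
      refine centFillingArea_congr r ?_
      have := QuotientGroup.out_eq' ((⟨z, hz⟩ : relSubgroup r) : RelQuot r)
      rw [QuotientGroup.eq, Subgroup.mem_subgroupOf] at this
      exact this
    simp only [h2] at h1
    have h3 : (centFillingArea r z : ℝ) ≤ _ := Nat.cast_le.2 h1
    refine h3.trans (le_of_eq ?_)
    push_cast
    congr 2
    refine Finset.sum_congr rfl fun i _ => ?_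
    rw [charFun, dif_pos hz, Nat.cast_natAbs, Int.cast_abs]
  rcases isEmpty_or_nonempty ι with hι0 | hι0
  · refine ⟨fun _ => 0, by simp, by simp, fun w _ => by simp; positivity, ?_⟩
    simp only [Finset.univ_eq_empty, Finset.sum_empty] at hz1
    refine hz1.trans ?_
    simp
  · obtain ⟨i, hi⟩ := Finite.exists_max fun i => |charFun r (f i) z|
    have hsum : ∑ j, |charFun r (f j) z| ≤ Fintype.card ι * |charFun r (f i) z| := by
      simpa using Finset.sum_le_card_nsmul Finset.univ _ _ fun j _ => hi j
    have hle : (centFillingArea r z : ℝ) ≤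
        (C * (1 + Fintype.card ι) + 1) * (1 + |charFun r (f i) z|) := by
      refine hz1.trans ?_
      have h1 := abs_nonneg (charFun r (f i) z)
      have h2 : (C : ℝ) * (1 + ∑ j, |charFun r (f j) z|) ≤
          C * (1 + Fintype.card ι * |charFun r (f i) z|) := by gcongr
      have h3 : (0 : ℝ) ≤ C * Fintype.card ι := by positivity
      have h4 : (0 : ℝ) ≤ C * |charFun r (f i) z| := by positivity
      nlinarith
    have hmul := charFun_mul r (f i)
    have hconj := charFun_conj r (f i)
    have hfill := fun w hw => abs_le_mul_fillingArea hmul hconj (hB i) (w := w) hw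
    rcases le_total 0 (charFun r (f i) z) with h | h
    · rw [abs_of_nonneg h] at hle
      exact ⟨charFun r (f i), hmul, hconj, hfill, hle⟩
    · rw [abs_of_nonpos h] at hle
      refine ⟨fun x => -charFun r (f i) x, fun x hx y hy => ?_, fun x hx y => ?_,
        fun w hw => ?_, hle⟩
      · simp only [hmul x hx y hy]; ring
      · simp only [hconj x hx y]
      · rw [abs_neg]; exact hfill w hw

end Characters

section LowerBound

variable (r : Fin s → FreeGroup (Fin d))

lemma closedWords_nonempty (n : ℕ) : (closedWords r n).Nonempty := by
  classical
  refine ⟨fun _ => none, Finset.mem_filter.2 ⟨Finset.mem_univ _, ?_⟩⟩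
  have : partialProd (fun _ : Fin n => (none : Letter d)) n = 1 := by
    simp [partialProd, letterVal]
  rw [this]
  exact one_mem _

lemma exists_centFillingArea_eq_centDehn {n : ℕ} (h : 0 < centDehn r n) :
    ∃ z ∈ relSubgroup r, z.norm ≤ n ∧ centFillingArea r z = centDehn r n := by
  have hmem : centDehn r n ∈
      { A | ∃ w ∈ relSubgroup r, FreeGroup.norm w ≤ n ∧ A = centFillingArea r w } := by
    refine Nat.sSup_mem ⟨_, 1, one_mem _, by simp, rfl⟩ ?_
    by_contra hb
    rw [centDehn, Nat.sSup_of_not_bddAbove hb] at h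
    exact lt_irrefl _ h
  obtain ⟨z, hz, hn, he⟩ := hmem
  exact ⟨z, hz, hn, he.symm⟩

/-- In the nilpotent case, the averaged Dehn function is bounded below by the values at words of
length `O(√n)` of any character of `R / [R,F]`. -/
theorem exists_character_le_avgDehn
    (hnilp : Group.IsNilpotent (FreeGroup (Fin d) ⧸ relSubgroup r)) :
    ∃ ε : ℝ, 0 < ε ∧ ∀ (φ : FreeGroup (Fin d) → ℝ) (B : ℝ),
      (∀ x ∈ relSubgroup r, ∀ y ∈ relSubgroup r, φ (x * y) = φ x + φ y) →
      (∀ x ∈ relSubgroup r, ∀ y, φ (y⁻¹ * x * y) = φ x) →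
      (∀ w ∈ relSubgroup r, |φ w| ≤ B * fillingArea r w) →
      ∀ z ∈ relSubgroup r, 0 < φ z → ∀ n : ℕ, 4 ≤ n → (z.norm : ℝ) ≤ ε * √n →
      φ z ≤ 2 * Real.pi * B * avgDehn r n := by
  classical
  obtain ⟨M, hM⟩ := exists_doubling (quotLetter (relSubgroup r))
    (exists_quotLetter_eq_inv (relSubgroup r)) hnilp
  obtain ⟨C, hC0, hC⟩ := exists_returnProb_doubling (relSubgroup r) (M := M) hM
  obtain ⟨ε, hε, h⟩ := exists_half_card_le_sum_abs hC0 hC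
  refine ⟨ε, hε, fun φ B hφ hconj hB z hz hz0 n hn hzn => ?_⟩
  have hpi := Real.pi_pos
  have h1 := h (fun x => Real.pi / φ z * φ x) (fun x hx y hy => by simp only [hφ x hx y hy]; ring)
    (fun x hx y => by simp only [hconj x hx y]) z hz (by field_simp) n hn hzn
  rw [← Finset.sum_filter, ← Finset.sum_filter, Finset.sum_const, nsmul_eq_mul, mul_one] at h1
  have hcw : closedWords r n = Finset.univ.filter (fun w => partialProd w n ∈ relSubgroup r) := by
    ext w; simp [closedWords]
  rw [← hcw] at h1
  have hcard : (0 : ℝ) < (closedWords r n).card := by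
    exact_mod_cast (closedWords_nonempty r n).card_pos
  have h2 : ∑ w ∈ closedWords r n, |Real.pi / φ z * φ (partialProd w n)| ≤
      Real.pi / φ z * (B * ∑ w ∈ closedWords r n, (fillingArea r (partialProd w n) : ℝ)) := by
    rw [Finset.mul_sum, Finset.mul_sum]
    refine Finset.sum_le_sum fun w hw => ?_
    rw [abs_mul, abs_of_pos (by positivity : 0 < Real.pi / φ z)]
    gcongr
    exact hB _ (by rw [hcw] at hw; exact (Finset.mem_filter.1 hw).2)
  rw [avgDehn, ← mul_div_assoc, le_div_iff₀ hcard]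
  have h3 := h1.trans h2
  rw [div_mul_eq_mul_div (Real.pi), le_div_iff₀ hz0] at h3
  linarith

end LowerBound

theorem avgDehn_lower_of_centDehn_lower {d s : ℕ} (r : Fin s → FreeGroup (Fin d))
    (hnilp : Group.IsNilpotent (FreeGroup (Fin d) ⧸ relSubgroup r))
    (k : ℝ) (hk : 2 ≤ k)
    (hcent : ∃ c : ℝ, 0 < c ∧ ∃ N₀ : ℕ, ∀ n : ℕ, N₀ ≤ n →
      c * (n : ℝ) ^ k ≤ (centDehn r n : ℝ)) :
    ∃ c' : ℝ, 0 < c' ∧ ∃ N₁ : ℕ, ∀ n : ℕ, N₁ ≤ n →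
      c' * (n : ℝ) ^ (k / 2) ≤ avgDehn r n := by
  obtain ⟨c, hc0, N₀, hc⟩ := hcent
  obtain ⟨ε, hε, hlow⟩ := exists_character_le_avgDehn r hnilp
  obtain ⟨B, hB0, C, hC0, hchar⟩ := exists_character_lower_bound r
  have hpi := Real.pi_pos
  have hk0 : 0 < k := by linarith
  have hlim : Filter.Tendsto (fun n : ℕ => ε * √(n : ℝ)) Filter.atTop Filter.atTop :=
    (Real.tendsto_sqrt_atTop.comp tendsto_natCast_atTop_atTop).const_mul_atTop hε
  obtain ⟨N, hN⟩ := Filter.eventually_atTop.1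
    (hlim.eventually_ge_atTop (N₀ + 2 + 2 * C / c + 1))
  refine ⟨c * (ε / 2) ^ k / (2 * C) / (2 * Real.pi * B), by positivity, max N 4, fun n hn => ?_⟩
  have hx := hN n (le_of_max_le_left hn)
  have hCc : 0 < 2 * C / c := by positivity
  have hN0 : (0 : ℝ) ≤ N₀ := by positivity
  set ℓ := ⌊ε * √(n : ℝ)⌋₊ with hℓ
  have hℓ1 : (ℓ : ℝ) ≤ ε * √n := Nat.floor_le (by positivity)
  have hℓ2 : ε * √n < ℓ + 1 := Nat.lt_floor_add_one _
  have hℓC : 2 * C / c ≤ ℓ := by linarith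
  have hℓ3 : (1 : ℝ) ≤ ℓ := by linarith
  have hℓN : N₀ ≤ ℓ := by exact_mod_cast (by linarith : (N₀ : ℝ) ≤ ℓ)
  have hcl := hc ℓ hℓN
  have hpow0 : (0 : ℝ) < (ℓ : ℝ) ^ k := Real.rpow_pos_of_pos (by linarith) _
  obtain ⟨z, hz, hzℓ, hzc⟩ := exists_centFillingArea_eq_centDehn r (n := ℓ) (by
    have : (0 : ℝ) < centDehn r ℓ := lt_of_lt_of_le (by positivity) hcl
    exact_mod_cast this)
  obtain ⟨φ, hφ, hconj, hB, hCz⟩ := hchar z hz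
  have hpow1 : (ℓ : ℝ) ≤ (ℓ : ℝ) ^ k := by
    simpa using Real.rpow_le_rpow_of_exponent_le hℓ3 (by linarith : 1 ≤ k)
  have hcC : 2 * C ≤ c * (ℓ : ℝ) ^ k := by
    rw [div_le_iff₀ hc0] at hℓC
    nlinarith
  have hφz : c * (ℓ : ℝ) ^ k / (2 * C) ≤ φ z := by
    rw [div_le_iff₀ (by positivity)]
    rw [hzc] at hCz
    linarith
  have hφz0 : 0 < φ z := lt_of_lt_of_le (by positivity) hφz
  have hfin := hlow φ B hφ hconj hB z hz hφz0 n (le_of_max_le_right hn)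
    ((Nat.cast_le.2 hzℓ).trans hℓ1)
  have hnk : (ε / 2) ^ k * (n : ℝ) ^ (k / 2) ≤ (ℓ : ℝ) ^ k := by
    have h1 : (n : ℝ) ^ (k / 2) = √n ^ k := by
      rw [Real.sqrt_eq_rpow, ← Real.rpow_mul (by positivity)]
      congr 1; ring
    rw [h1, ← Real.mul_rpow (by positivity) (by positivity)]
    exact Real.rpow_le_rpow (by positivity) (by linarith) hk0.le
  rw [div_mul_eq_mul_div, div_le_iff₀ (by positivity), mul_comm (avgDehn r n)]
  refine le_trans ?_ (hφz.trans hfin)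
  rw [div_mul_eq_mul_div, mul_assoc]
  gcongr

end AvgDehnPaper
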